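/- Let F ∈ R^{3×3} with d_3(F) = det F associated to x_1^{p} x_2^{q} for positive integers p, q. If J_i(F) = R for i = 1,2,3, then F is equivalent to its Smith normal form D = diag(x_1^{r_1}x_2^{s_1}, x_1^{r_2}x_2^{s_2}, x_1^{r_3}x_2^{s_3}), where d_i(F) is associated to x_1^{p_i}x_2^{q_i}, p_0 = q_0 = 0, r_i = p_i − p_{i−1}, s_i = q_i − q_{i−1} for i = 1,2,3, and moreover r_1 ≤ r_2 ≤ r_3 and s_1 ≤ s_2 ≤ s_3. -/

import Mathlib

open Matrix MvPolynomial

/-- The set of `k × k` minors of a matrix: determinants of submatrices obtained by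
choosing `k` rows and `k` columns. -/
def minorsSet {R : Type*} [CommRing R] {l m : ℕ} (k : ℕ)
    (F : Matrix (Fin l) (Fin m) R) : Set R :=
  { d | ∃ (ri : Fin k → Fin l) (ci : Fin k → Fin m),
      Function.Injective ri ∧ Function.Injective ci ∧ d = (F.submatrix ri ci).det }

/-- `d` is a greatest common divisor of the `k × k` minors of `F`. -/
def IsGcdMinors {R : Type*} [CommRing R] {l m : ℕ} (k : ℕ)
    (F : Matrix (Fin l) (Fin m) R) (d : R) : Prop :=
  (∀ a ∈ minorsSet k F, d ∣ a) ∧ ∀ e : R, (∀ a ∈ minorsSet k F, e ∣ a) → e ∣ d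

/-- `J_k(F) = R` : the ideal generated by the reduced `k`-th order minors
(the `k × k` minors divided by their g.c.d.) is the unit ideal. -/
def JEqTop {R : Type*} [CommRing R] {l m : ℕ} (k : ℕ)
    (F : Matrix (Fin l) (Fin m) R) : Prop :=
  ∃ d : R, IsGcdMinors k F d ∧ Ideal.span { b : R | d * b ∈ minorsSet k F } = ⊤

/-- The normal rank of a polynomial matrix: its rank over the fraction field. -/
noncomputable def normalRank {K : Type*} [Field K] {n l m : ℕ}
    (F : Matrix (Fin l) (Fin m) (MvPolynomial (Fin n) K)) : ℕ :=
  (F.map (algebraMap (MvPolynomial (Fin n) K)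
      (FractionRing (MvPolynomial (Fin n) K)))).rank

/-- Equivalence of matrices: `G = M * F * N` with `M`, `N` unimodular
(i.e. with determinant a unit, a nonzero constant). -/
def MatEquiv {R : Type*} [CommRing R] {l m : ℕ}
    (F G : Matrix (Fin l) (Fin m) R) : Prop :=
  ∃ (M : Matrix (Fin l) (Fin l) R) (N : Matrix (Fin m) (Fin m) R),
    IsUnit M.det ∧ IsUnit N.det ∧ G = M * F * N

/-- A matrix is zero left prime (ZLP) if its maximal (row-size) order minors
generate the unit ideal. -/
def ZLP {R : Type*} [CommRing R] {l m : ℕ} (F : Matrix (Fin l) (Fin m) R) : Prop :=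
  Ideal.span (minorsSet l F) = ⊤

/-- A vector is unimodular if its entries generate the unit ideal. -/
def IsUnimodularVec {S ι : Type*} [CommRing S] [Fintype ι] (f : ι → S) : Prop :=
  ∃ g : ι → S, g ⬝ᵥ f = 1

/-- Two vectors are equivalent if an invertible matrix takes one to the other. -/
def VecEquiv {S ι : Type*} [CommRing S] [Fintype ι] [DecidableEq ι] (f g : ι → S) : Prop :=
  ∃ G H : Matrix ι ι S, G * H = 1 ∧ G *ᵥ f = g

section VecEquiv

variable {S T ι : Type*} [CommRing S] [CommRing T] [Fintype ι] [DecidableEq ι]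

theorem VecEquiv.refl (f : ι → S) : VecEquiv f f := ⟨1, 1, by simp, by simp⟩

theorem VecEquiv.symm {f g : ι → S} (h : VecEquiv f g) : VecEquiv g f := by
  obtain ⟨G, H, hGH, rfl⟩ := h
  refine ⟨H, G, mul_eq_one_comm.mp hGH, ?_⟩
  rw [Matrix.mulVec_mulVec, mul_eq_one_comm.mp hGH, Matrix.one_mulVec]

theorem VecEquiv.trans {f g h : ι → S} (h₁ : VecEquiv f g) (h₂ : VecEquiv g h) :
    VecEquiv f h := by
  obtain ⟨G, H, hGH, rfl⟩ := h₁
  obtain ⟨G', H', hGH', rfl⟩ := h₂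
  refine ⟨G' * G, H * H', ?_, by rw [Matrix.mulVec_mulVec]⟩
  rw [Matrix.mul_assoc, ← Matrix.mul_assoc G, hGH, Matrix.one_mul, hGH']

omit [DecidableEq ι] in
theorem IsUnimodularVec.map {f : ι → S} (hf : IsUnimodularVec f) (φ : S →+* T) :
    IsUnimodularVec (fun i => φ (f i)) := by
  obtain ⟨g, hg⟩ := hf
  refine ⟨fun i => φ (g i), ?_⟩
  have := congrArg φ hg
  simpa [dotProduct] using this

theorem VecEquiv.map {f g : ι → S} (h : VecEquiv f g) (φ : S →+* T) :
    VecEquiv (fun i => φ (f i)) (fun i => φ (g i)) := by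
  obtain ⟨G, H, hGH, rfl⟩ := h
  refine ⟨G.map φ, H.map φ, ?_, ?_⟩
  · rw [← Matrix.map_mul, hGH, Matrix.map_one _ (map_zero φ) (map_one φ)]
  · ext i
    exact (RingHom.map_mulVec φ G f i).symm

omit [DecidableEq ι] in
theorem IsUnimodularVec.of_mulVec {G : Matrix ι ι S} {f : ι → S}
    (h : IsUnimodularVec (G *ᵥ f)) : IsUnimodularVec f := by
  obtain ⟨g, hg⟩ := h
  exact ⟨g ᵥ* G, by rw [← Matrix.dotProduct_mulVec, hg]⟩

theorem VecEquiv.isUnimodularVec {f g : ι → S} (h : VecEquiv f g) (hf : IsUnimodularVec f) :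
    IsUnimodularVec g := by
  obtain ⟨G, H, -, rfl⟩ := h.symm
  exact hf.of_mulVec

/-- Adding a multiple `(w ⬝ᵥ f) • v` to `f`, where `w` annihilates `v`. -/
theorem VecEquiv.add_smul (f v w : ι → S) (h : w ⬝ᵥ v = 0) :
    VecEquiv f (f + (w ⬝ᵥ f) • v) := by
  refine ⟨1 + vecMulVec v w, 1 - vecMulVec v w, ?_, ?_⟩
  · have : vecMulVec v w * vecMulVec v w = 0 := by
      rw [Matrix.vecMulVec_mul_vecMulVec, h]; simp
    rw [mul_sub, add_mul, add_mul, this]; simp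
  · rw [Matrix.add_mulVec, Matrix.one_mulVec, Matrix.vecMulVec_mulVec]
    simp

theorem VecEquiv.single_of_eq_one {f : ι → S} {i : ι} (h : f i = 1) :
    VecEquiv f (Pi.single i 1) := by
  have := VecEquiv.add_smul f (Pi.single i 1 - f) (Pi.single i 1) (by simp [h])
  simpa [h] using this

theorem VecEquiv.update_add {f w : ι → S} {k : ι} (hw : w k = 0) :
    VecEquiv f (f + Pi.single k (w ⬝ᵥ f)) := by
  have := VecEquiv.add_smul f (Pi.single k 1) w (by simp [hw])
  convert this using 2
  ext j
  by_cases hj : j = k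
  · subst hj; simp
  · simp [hj]

theorem VecEquiv.single_of_isUnit_of_ne {f : ι → S} {i j : ι} (h : IsUnit (f i)) (hij : i ≠ j) :
    VecEquiv f (Pi.single j 1) := by
  obtain ⟨a, ha⟩ := h.exists_left_inv
  refine (VecEquiv.update_add (w := Pi.single i ((1 - f j) * a)) (k := j)
    (by simp [hij.symm])).trans (VecEquiv.single_of_eq_one ?_)
  simp [mul_assoc, ha]

theorem VecEquiv.single_of_isUnit [Nontrivial ι] {f : ι → S} {i : ι} (h : IsUnit (f i)) (j : ι) :
    VecEquiv f (Pi.single j 1) := by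
  by_cases hij : i = j
  · subst hij
    obtain ⟨k, hk⟩ := exists_ne i
    refine (VecEquiv.single_of_isUnit_of_ne h hk.symm).trans
      (VecEquiv.single_of_isUnit_of_ne (i := k) (by simp) hk)
  · exact VecEquiv.single_of_isUnit_of_ne h hij

end VecEquiv

section Horrocks

open Polynomial

variable {A : Type*} [CommRing A]

theorem degree_C_mul_le_degree (c : A) (p : A[X]) : (Polynomial.C c * p).degree ≤ p.degree := by
  rw [← Polynomial.smul_eq_C_mul]
  exact Polynomial.degree_smul_le c p

/-- If a monic `f` of degree `d` and a polynomial `g` of smaller degree with a unit coefficient are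
given, the ideal `(f, g)` contains a monic polynomial of degree `d - 1`. -/
theorem exists_combination_coeff_eq_one [Nontrivial A] {f g : A[X]}
    (hf : f.Monic) (hg : g.degree < f.degree)
    {k : ℕ} (hk : IsUnit (g.coeff k)) :
    ∃ a b : A[X], (a * f + b * g).degree < f.degree ∧
      (a * f + b * g).coeff (f.natDegree - 1) = 1 := by
  set d := f.natDegree with hd
  have hfd : f.degree = d := Polynomial.degree_eq_natDegree hf.ne_zero
  let I : Ideal A :=
    { carrier := {c | ∃ a b : A[X], (a * f + b * g).degree < f.degree ∧
        (a * f + b * g).coeff (d - 1) = c}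
      add_mem' := by
        rintro _ _ ⟨a, b, h, rfl⟩ ⟨a', b', h', rfl⟩
        refine ⟨a + a', b + b', ?_, ?_⟩
        · have : (a + a') * f + (b + b') * g = (a * f + b * g) + (a' * f + b' * g) := by ring
          rw [this]
          exact (Polynomial.degree_add_le _ _).trans_lt (max_lt h h')
        · rw [← Polynomial.coeff_add]; congr 1; ring
      zero_mem' := ⟨0, 0, by simp [hfd], by simp⟩
      smul_mem' := by
        rintro c _ ⟨a, b, h, rfl⟩
        refine ⟨Polynomial.C c * a, Polynomial.C c * b, ?_, ?_⟩
        · have : Polynomial.C c * a * f + Polynomial.C c * b * g =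
              Polynomial.C c * (a * f + b * g) := by ring
          rw [this]
          exact (degree_C_mul_le_degree _ _).trans_lt h
        · rw [smul_eq_mul, ← Polynomial.coeff_C_mul]; congr 1; ring }
  have key : ∀ j < d, ∀ a b : A[X], (a * f + b * g).degree < f.degree →
      (a * f + b * g).coeff (d - 1 - j) ∈ I := by
    intro j
    induction j with
    | zero => intro _ a b h; exact ⟨a, b, h, rfl⟩
    | succ j ih =>
      intro hj a b h
      set p := a * f + b * g with hp
      have hp' : (Polynomial.X * a - Polynomial.C (p.coeff (d - 1))) * f + (Polynomial.X * b) * g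
          = Polynomial.X * p - Polynomial.C (p.coeff (d - 1)) * f := by rw [hp]; ring
      have hdeg : (Polynomial.X * p - Polynomial.C (p.coeff (d - 1)) * f).degree < f.degree := by
        rw [hfd, Polynomial.degree_lt_iff_coeff_zero]
        intro m hm
        obtain ⟨m, rfl⟩ : ∃ m', m = m' + 1 := ⟨m - 1, by omega⟩
        rw [Polynomial.coeff_sub, Polynomial.coeff_X_mul, Polynomial.coeff_C_mul]
        rcases eq_or_lt_of_le hm with hm | hm
        · rw [← hm, hd, hf.coeff_natDegree, ← hd, hm, mul_one, Nat.add_sub_cancel, sub_self]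
        · rw [Polynomial.coeff_eq_zero_of_natDegree_lt (p := f) (by omega), mul_zero, sub_zero]
          apply Polynomial.coeff_eq_zero_of_degree_lt
          refine h.trans_le ?_
          rw [hfd]; exact_mod_cast (by omega : d ≤ m)
      have h1 := ih (by omega) (Polynomial.X * a - Polynomial.C (p.coeff (d - 1)))
        (Polynomial.X * b) (by rw [hp']; exact hdeg)
      rw [hp', show d - 1 - j = (d - 1 - (j + 1)) + 1 by omega, Polynomial.coeff_sub,
        Polynomial.coeff_X_mul, Polynomial.coeff_C_mul] at h1
      have h2 : p.coeff (d - 1) ∈ I := ⟨a, b, h, rfl⟩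
      have := I.add_mem h1 (I.mul_mem_right (f.coeff (d - 1 - (j + 1) + 1)) h2)
      rwa [sub_add_cancel] at this
  have hkd : k < d := by
    by_contra hcon
    rw [Polynomial.coeff_eq_zero_of_degree_lt (hg.trans_le
      (by rw [hfd]; exact_mod_cast not_lt.mp hcon))] at hk
    exact not_isUnit_zero hk
  have h1 := key (d - 1 - k) (by omega) 0 1 (by simpa using hg)
  rw [show d - 1 - (d - 1 - k) = k by omega] at h1
  have : (1 : A) ∈ I := by
    obtain ⟨u, hu⟩ := hk.exists_left_inv
    rw [← hu]
    exact I.mul_mem_left _ (by simpa using h1)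
  exact this

theorem exists_isUnit_coeff_of_isUnimodularVec [IsLocalRing A] {ι : Type*} [Fintype ι]
    {f : ι → A[X]} (hf : IsUnimodularVec f) {i : ι} (hi : (f i).Monic)
    (hdeg : (f i).natDegree ≠ 0) : ∃ j ≠ i, ∃ k, IsUnit ((f j).coeff k) := by
  classical
  by_contra! hcon
  obtain ⟨g, hg⟩ := hf.map (Polynomial.mapRingHom (IsLocalRing.residue A))
  have h0 : ∀ j ≠ i, (f j).map (IsLocalRing.residue A) = 0 := by
    intro j hj
    ext k
    rw [Polynomial.coeff_map, Polynomial.coeff_zero, IsLocalRing.residue_eq_zero_iff]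
    exact hcon j hj k
  rw [dotProduct, Finset.sum_eq_single i (by intro j _ hj; simp [h0 j hj]) (by simp)] at hg
  have h1 : IsUnit ((f i).map (IsLocalRing.residue A)) := IsUnit.of_mul_eq_one_right _ hg
  apply hdeg
  rw [← hi.natDegree_map (IsLocalRing.residue A)]
  exact Polynomial.natDegree_eq_zero_of_isUnit h1

/-- **Horrocks' theorem** for unimodular vectors: over a local ring, a unimodular vector of
polynomials with a monic entry is equivalent to a standard basis vector. -/
theorem IsUnimodularVec.vecEquiv_single_of_monic [IsLocalRing A] {f : Fin 3 → A[X]}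
    (hf : IsUnimodularVec f) {i : Fin 3} (hi : (f i).Monic) (l : Fin 3) :
    VecEquiv f (Pi.single l 1) := by
  induction hd : (f i).natDegree generalizing f i with
  | zero =>
    rw [Polynomial.Monic.natDegree_eq_zero hi] at hd
    exact VecEquiv.single_of_isUnit (i := i) (by simp [hd]) l
  | succ d ih =>
    let f' : Fin 3 → A[X] := fun j => if j = i then f i else f j %ₘ f i
    have hff' : VecEquiv f f' := by
      have := VecEquiv.add_smul f (fun j => if j = i then 0 else - (f j /ₘ f i)) (Pi.single i 1)
        (by simp)
      convert this using 2
      ext1 j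
      by_cases hj : j = i
      · simp [f', hj]
      · have := Polynomial.modByMonic_add_div (f j) (f i)
        simp only [f', hj, if_false, Pi.add_apply, Pi.smul_apply, smul_eq_mul, single_dotProduct,
          one_mul]
        linear_combination this
    have hf'i : f' i = f i := by simp [f']
    have hf'j : ∀ j ≠ i, (f' j).degree < (f i).degree := by
      intro j hj
      simp only [f', hj, if_false]
      exact Polynomial.degree_modByMonic_lt _ hi
    have hf'u := hff'.isUnimodularVec hf
    obtain ⟨j, hj, k, hk⟩ := exists_isUnit_coeff_of_isUnimodularVec hf'u (i := i)
      (by rwa [hf'i]) (by rw [hf'i]; omega)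
    obtain ⟨a, b, hab, hab'⟩ := exists_combination_coeff_eq_one hi (hf'j j hj) hk
    obtain ⟨m, hmi, hmj⟩ : ∃ m, m ≠ i ∧ m ≠ j :=
      (by decide : ∀ i j : Fin 3, ∃ m, m ≠ i ∧ m ≠ j) i j
    set h := a * f i + b * f' j with hh
    have hfi : (f i).degree = (d + 1 : ℕ) := by
      rw [Polynomial.degree_eq_natDegree hi.ne_zero, hd]
    rw [hd, Nat.add_sub_cancel] at hab'
    let e : A[X] := Polynomial.C (1 - (f' m).coeff d)
    let w : Fin 3 → A[X] := Pi.single i (e * a) + Pi.single j (e * b)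
    have hw : w ⬝ᵥ f' = e * h := by
      simp only [w, add_dotProduct, single_dotProduct, hf'i, hh]
      ring
    have hstep : VecEquiv f' (f' + Pi.single m (w ⬝ᵥ f')) :=
      VecEquiv.update_add (by simp [w, hmi, hmj])
    have hm : (f' + Pi.single m (w ⬝ᵥ f') : Fin 3 → A[X]) m = f' m + e * h := by simp [hw]
    have hdeg : (f' m + e * h).degree ≤ d := by
      have h1 : (f' m + e * h).degree < (d + 1 : ℕ) := by
        rw [← hfi]
        exact (Polynomial.degree_add_le _ _).trans_lt
          (max_lt (hf'j m hmi) ((degree_C_mul_le_degree _ _).trans_lt hab))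
      rw [Polynomial.degree_lt_iff_coeff_zero] at h1
      rw [Polynomial.degree_le_iff_coeff_zero]
      intro N hN
      exact h1 N (by exact_mod_cast hN)
    have hcoeff : (f' m + e * h).coeff d = 1 := by
      rw [Polynomial.coeff_add, Polynomial.coeff_C_mul, hab']; ring
    have hmonic : (f' m + e * h).Monic := Polynomial.monic_of_degree_le d hdeg hcoeff
    refine hff'.trans (hstep.trans (ih (hstep.isUnimodularVec hf'u) (i := m) ?_ ?_))
    · rwa [hm]
    · rw [hm]
      refine Polynomial.natDegree_eq_of_le_of_coeff_ne_zero
        (Polynomial.natDegree_le_of_degree_le hdeg) ?_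
      rw [hcoeff]; exact one_ne_zero

end Horrocks

section Patching

open Polynomial

variable {A : Type*} [CommRing A]

theorem C_dvd_comp_sub_comp {c : A} {s t : A[X]} (h : Polynomial.C c ∣ s - t) (p : A[X]) :
    Polynomial.C c ∣ p.comp s - p.comp t := by
  refine h.trans ?_
  rw [Polynomial.comp, Polynomial.comp, Polynomial.eval₂_eq_eval_map,
    Polynomial.eval₂_eq_eval_map]
  exact Polynomial.sub_dvd_eval_sub _ _ _

theorem exists_comp_transition [IsDomain A] {ι : Type*} [Fintype ι] [DecidableEq ι] {c : A}
    (hc : c ≠ 0) {N N' : Matrix ι ι A[X]} (h₁ : N * N' = Polynomial.C c • 1)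
    {f : ι → A[X]} {w : ι → A} (hw : N' *ᵥ f = fun j => Polynomial.C (w j)) {s t : A[X]}
    (hst : Polynomial.C c ∣ s - t) :
    ∃ G : Matrix ι ι A[X], Polynomial.C c • G =
        N.map (Polynomial.compRingHom s) * N'.map (Polynomial.compRingHom t) ∧
      G *ᵥ (fun j => (f j).comp t) = fun j => (f j).comp s := by
  have hcomp : ∀ r : A[X], N.map (Polynomial.compRingHom r) * N'.map (Polynomial.compRingHom r) =
      Polynomial.C c • 1 := by
    intro r
    rw [← Matrix.map_mul, h₁]
    ext i j
    by_cases hij : i = j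
    · subst hij; simp
    · simp [hij]
  have hw' : ∀ r : A[X], N'.map (Polynomial.compRingHom r) *ᵥ (fun j => (f j).comp r) =
      fun j => Polynomial.C (w j) := by
    intro r
    ext1 i
    have := congrFun hw i
    have h3 := RingHom.map_mulVec (Polynomial.compRingHom r) N' f i
    rw [this] at h3
    simpa [Function.comp_def] using! h3.symm
  choose D hD using fun i j => C_dvd_comp_sub_comp hst (N i j)
  have hD' : N.map (Polynomial.compRingHom s) = N.map (Polynomial.compRingHom t) +
      Polynomial.C c • Matrix.of D := by
    ext1 i j
    have := hD i j
    simp only [Matrix.map_apply, Polynomial.coe_compRingHom_apply, Matrix.add_apply,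
      Matrix.smul_apply, Matrix.of_apply, smul_eq_mul]
    linear_combination this
  have hG : Polynomial.C c • (1 + Matrix.of D * N'.map (Polynomial.compRingHom t)) =
      N.map (Polynomial.compRingHom s) * N'.map (Polynomial.compRingHom t) := by
    rw [hD', Matrix.add_mul, hcomp, smul_add, Matrix.smul_mul]
  refine ⟨_, hG, ?_⟩
  have hc' : Polynomial.C c ≠ 0 := by simpa using hc
  apply smul_right_injective (ι → A[X]) hc'
  simp only
  rw [← Matrix.smul_mulVec, hG, ← Matrix.mulVec_mulVec, hw', ← hw' s, Matrix.mulVec_mulVec, hcomp,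
    Matrix.smul_mulVec, Matrix.one_mulVec]

theorem vecEquiv_comp_of_dvd [IsDomain A] {ι : Type*} [Fintype ι] [DecidableEq ι] {c : A}
    (hc : c ≠ 0) {N N' : Matrix ι ι A[X]} (h₁ : N * N' = Polynomial.C c • 1)
    (h₂ : N' * N = Polynomial.C c • 1)
    {f : ι → A[X]} {w : ι → A} (hw : N' *ᵥ f = fun j => Polynomial.C (w j)) {s t : A[X]}
    (hst : Polynomial.C c ∣ s - t) :
    VecEquiv (fun j => (f j).comp s) (fun j => (f j).comp t) := by
  obtain ⟨G, hG, -⟩ := exists_comp_transition hc h₁ hw hst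
  obtain ⟨G', hG', hf⟩ := exists_comp_transition hc h₁ hw ((dvd_sub_comm).mp hst)
  refine ⟨G', G, ?_, hf⟩
  have hc' : Polynomial.C c * Polynomial.C c ≠ 0 := by simpa using hc
  have hcomp : ∀ r : A[X], N'.map (Polynomial.compRingHom r) * N.map (Polynomial.compRingHom r) =
      Polynomial.C c • 1 ∧ N.map (Polynomial.compRingHom r) * N'.map (Polynomial.compRingHom r) =
      Polynomial.C c • 1 := by
    intro r
    rw [← Matrix.map_mul, ← Matrix.map_mul, h₁, h₂]
    constructor <;>
    · ext i j
      by_cases hij : i = j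
      · subst hij; simp
      · simp [hij]
  apply smul_right_injective (Matrix ι ι A[X]) hc'
  simp only
  calc (Polynomial.C c * Polynomial.C c) • (G' * G)
      = (Polynomial.C c • G') * (Polynomial.C c • G) := by
        rw [Matrix.smul_mul, Matrix.mul_smul, smul_smul]
    _ = N.map (Polynomial.compRingHom t) * (N'.map (Polynomial.compRingHom s) *
          N.map (Polynomial.compRingHom s)) * N'.map (Polynomial.compRingHom t) := by
        rw [hG, hG']; simp only [Matrix.mul_assoc]
    _ = _ := by
        rw [(hcomp s).1, Matrix.mul_smul, Matrix.mul_one, Matrix.smul_mul, (hcomp t).2, smul_smul]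

theorem exists_map_eq_C_smul (M : Submonoid A) (L : Type*) [CommRing L] [Algebra A L]
    [IsLocalization M L] {ι : Type*} [Finite ι] (P : Matrix ι ι L[X]) :
    ∃ b ∈ M, ∃ N : Matrix ι ι A[X], N.map (Polynomial.mapRingHom (algebraMap A L)) =
      Polynomial.C (algebraMap A L b) • P := by
  let _ := Polynomial.algebra A L
  have := Polynomial.isLocalization M L
  obtain ⟨⟨b', hb'⟩, hb⟩ := IsLocalization.exist_integer_multiples_of_finite
    (M.map (Polynomial.C : A →+* A[X])) (fun k : ι × ι => P k.1 k.2)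
  obtain ⟨b, hbM, rfl⟩ := hb'
  choose N hN using hb
  refine ⟨b, hbM, Matrix.of fun i j => N (i, j), ?_⟩
  ext1 i j
  have := hN (i, j)
  rw [Polynomial.algebraMap_def] at this
  simpa [Algebra.smul_def, Polynomial.algebraMap_def] using this

/-- The ideal of those `c` for which evaluating `f` at polynomials congruent modulo `c` gives
equivalent vectors. -/
def vaserstein {ι : Type*} [Fintype ι] [DecidableEq ι] (f : ι → A[X]) : Ideal A where
  carrier := {c | ∀ s t : A[X], Polynomial.C c ∣ s - t →
    VecEquiv (fun j => (f j).comp s) (fun j => (f j).comp t)}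
  add_mem' := by
    rintro c d hc hd s t ⟨u, hu⟩
    refine (hc s (s - Polynomial.C c * u) ⟨u, by ring⟩).trans (hd _ t ⟨u, ?_⟩)
    rw [Polynomial.C_add] at hu
    linear_combination hu
  zero_mem' := by
    intro s t h
    rw [Polynomial.C_0, zero_dvd_iff, sub_eq_zero] at h
    subst h
    exact VecEquiv.refl _
  smul_mem' := by
    intro a c hc s t h
    refine hc s t (dvd_trans ?_ h)
    rw [smul_eq_mul, Polynomial.C_mul]
    exact dvd_mul_left _ _

theorem exists_mem_vaserstein [IsDomain A] {f : Fin 3 → A[X]} (hf : IsUnimodularVec f) {i : Fin 3}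
    (hi : (f i).Monic) (m : Ideal A) [m.IsPrime] : ∃ c ∈ vaserstein f, c ∉ m := by
  let L := Localization.AtPrime m
  let φ : A[X] →+* L[X] := Polynomial.mapRingHom (algebraMap A L)
  have hinj : Function.Injective φ := Polynomial.map_injective _
    (IsLocalization.injective L m.primeCompl_le_nonZeroDivisors)
  obtain ⟨P, Q, hPQ, hPf⟩ := (hf.map φ).vecEquiv_single_of_monic (i := i) (hi.map _) 0
  obtain ⟨b, hb, N', hN'⟩ := exists_map_eq_C_smul m.primeCompl L P
  obtain ⟨b', hb', N, hN⟩ := exists_map_eq_C_smul m.primeCompl L Q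
  have hmem : b * b' ∈ m.primeCompl := mul_mem hb hb'
  refine ⟨b * b', ?_, hmem⟩
  intro s t hst
  have hφC : ∀ a, φ (Polynomial.C a) = Polynomial.C (algebraMap A L a) := by
    intro a; simp [φ]
  have h1 : ∀ a : A, (Polynomial.C a • (1 : Matrix (Fin 3) (Fin 3) A[X])).map φ =
      Polynomial.C (algebraMap A L a) • 1 := by
    intro a
    ext1 k l
    by_cases hkl : k = l
    · subst hkl; simp [hφC]
    · simp [hkl]
  have hmapinj : Function.Injective (fun M : Matrix (Fin 3) (Fin 3) A[X] => M.map φ) :=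
    Matrix.map_injective hinj
  refine vecEquiv_comp_of_dvd (c := b * b') (N := N) (N' := N')
    (w := Pi.single 0 b) ?_ ?_ ?_ ?_ hst
  · rintro h; exact hmem (h ▸ m.zero_mem)
  · apply hmapinj
    simp only
    rw [Matrix.map_mul, h1, hN, hN', Matrix.smul_mul, Matrix.mul_smul, mul_eq_one_comm.mp hPQ,
      smul_smul, ← Polynomial.C_mul, ← map_mul, mul_comm b']
  · apply hmapinj
    simp only
    rw [Matrix.map_mul, h1, hN, hN', Matrix.smul_mul, Matrix.mul_smul, hPQ,
      smul_smul, ← Polynomial.C_mul, ← map_mul]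
  · ext1 k
    apply hinj
    rw [RingHom.map_mulVec, hN', Matrix.smul_mulVec]
    have := congrFun hPf k
    rw [Pi.smul_apply]
    erw [this]
    by_cases hk : k = 0
    · subst hk; simp [hφC]
    · simp [hk]

theorem IsUnimodularVec.vecEquiv_eval_zero [IsDomain A] {f : Fin 3 → A[X]}
    (hf : IsUnimodularVec f) {i : Fin 3} (hi : (f i).Monic) :
    VecEquiv f (fun j => Polynomial.C ((f j).eval 0)) := by
  have htop : vaserstein f = ⊤ := by
    by_contra h
    obtain ⟨m, hm, hle⟩ := Ideal.exists_le_maximal _ h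
    obtain ⟨c, hc, hcm⟩ := exists_mem_vaserstein hf hi m
    exact hcm (hle hc)
  have h1 : (1 : A) ∈ vaserstein f := htop ▸ Submodule.mem_top
  have := h1 Polynomial.X 0 (by simp)
  simpa using this

end Patching

section QuillenSuslin

variable {k : Type*} [Field k] {n : ℕ}

/-- The substitution `X i ↦ X i + c • X 0 ^ u ^ i` for `i ≠ 0`, fixing `X 0`. -/
noncomputable def nagataHom (u : ℕ) (c : k) :
    MvPolynomial (Fin (n + 1)) k →ₐ[k] MvPolynomial (Fin (n + 1)) k :=
  aeval fun i ↦ if i = 0 then X 0 else X i + c • X 0 ^ u ^ i.1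

theorem nagataHom_comp_neg (u : ℕ) (c : k) :
    (nagataHom (n := n) u c).comp (nagataHom u (-c)) = AlgHom.id _ _ := by
  rw [nagataHom, nagataHom, comp_aeval, ← MvPolynomial.aeval_X_left]
  ext i v
  cases i using Fin.cases <;> simp

/-- The substitution `nagataHom u 1` as an automorphism. -/
noncomputable def nagataEquiv (u : ℕ) :
    MvPolynomial (Fin (n + 1)) k ≃ₐ[k] MvPolynomial (Fin (n + 1)) k :=
  AlgEquiv.ofAlgHom (nagataHom u 1) (nagataHom u (-1))
    (nagataHom_comp_neg u 1) (by simpa using nagataHom_comp_neg u (-1 : k))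

theorem finSuccEquiv_nagataEquiv_X (u : ℕ) (i : Fin (n + 1)) :
    finSuccEquiv k n (nagataEquiv u (X i)) =
      if i = 0 then Polynomial.X else finSuccEquiv k n (X i) + Polynomial.X ^ u ^ i.1 := by
  by_cases h : i = 0 <;> simp [nagataEquiv, nagataHom, h, finSuccEquiv_X_zero]

theorem finSuccEquiv_nagataEquiv_X_monic (u : ℕ) (hu : u ≠ 0) (i : Fin (n + 1)) :
    (finSuccEquiv k n (nagataEquiv u (X i))).Monic ∧
      (finSuccEquiv k n (nagataEquiv u (X i))).natDegree = u ^ i.1 := by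
  rw [finSuccEquiv_nagataEquiv_X]
  cases i using Fin.cases with
  | zero => simp [Polynomial.monic_X]
  | succ i =>
    rw [if_neg (Fin.succ_ne_zero i), finSuccEquiv_X_succ, add_comm]
    exact ⟨Polynomial.monic_X_pow_add_C _ (pow_ne_zero _ hu), Polynomial.natDegree_X_pow_add_C⟩

theorem finSuccEquiv_nagataEquiv_monomial (u : ℕ) (hu : u ≠ 0) (v : Fin (n + 1) →₀ ℕ)
    {a : k} (ha : a ≠ 0) :
    (finSuccEquiv k n (nagataEquiv u (monomial v a))).natDegree = ∑ i, u ^ i.1 * v i ∧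
      (finSuccEquiv k n (nagataEquiv u (monomial v a))).leadingCoeff = C a := by
  have hmon : ∀ i ∈ Finset.univ,
      ((finSuccEquiv k n (nagataEquiv u (X i))) ^ v i).Monic := fun i _ =>
    (finSuccEquiv_nagataEquiv_X_monic u hu i).1.pow _
  have hC : finSuccEquiv k n (nagataEquiv u (C a)) = Polynomial.C (C a) := by
    simp [nagataEquiv, nagataHom, finSuccEquiv_apply]
  have hprod := Polynomial.monic_prod_of_monic _ _ hmon
  rw [monomial_eq, Finsupp.prod_fintype _ _ (fun i => pow_zero _)]
  simp only [map_mul, map_prod, map_pow, hC]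
  constructor
  · rw [Polynomial.natDegree_C_mul (by simpa using ha), Polynomial.natDegree_prod_of_monic _ _ hmon]
    refine Finset.sum_congr rfl fun i _ => ?_
    rw [(finSuccEquiv_nagataEquiv_X_monic u hu i).1.natDegree_pow,
      (finSuccEquiv_nagataEquiv_X_monic u hu i).2, mul_comm]
  · rw [Polynomial.leadingCoeff_mul_monic hprod, Polynomial.leadingCoeff_C]

theorem sum_pow_mul_injOn {u : ℕ} (hu : 1 < u) {v w : Fin (n + 1) →₀ ℕ} (hv : ∀ i, v i < u)
    (hw : ∀ i, w i < u) (h : ∑ i : Fin (n + 1), u ^ i.1 * v i = ∑ i : Fin (n + 1), u ^ i.1 * w i) :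
    v = w := by
  refine Finsupp.ext <| congrFun <| List.ofFn_inj.mp ?_
  apply Nat.ofDigits_inj_of_len_eq hu (by simp)
    (List.forall_mem_ofFn_iff.mpr hv) (List.forall_mem_ofFn_iff.mpr hw)
  simpa only [Nat.ofDigits_eq_sum_mapIdx, List.mapIdx_eq_ofFn, List.get_ofFn, List.length_ofFn,
    Fin.val_cast, mul_comm, List.sum_ofFn] using! h

/-- Nagata's change of variables makes the leading coefficient in `X 0` constant. -/
theorem exists_isUnit_leadingCoeff_nagataEquiv {f : MvPolynomial (Fin (n + 1)) k} (hf : f ≠ 0) :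
    ∃ u, IsUnit (finSuccEquiv k n (nagataEquiv u f)).leadingCoeff := by
  set u := 2 + f.totalDegree with hu
  refine ⟨u, ?_⟩
  let h := fun w => finSuccEquiv k n (nagataEquiv u (monomial w (coeff w f)))
  have hlt : ∀ v ∈ f.support, ∀ i, v i < u := fun v hv i =>
    lt_of_le_of_lt ((monomial_le_degreeOf i hv).trans (degreeOf_le_totalDegree f i)) (by omega)
  have hh : ∀ v ∈ f.support, (h v).natDegree = ∑ i : Fin (n + 1), u ^ i.1 * v i ∧
      (h v).leadingCoeff = C (coeff v f) := fun v hv =>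
    finSuccEquiv_nagataEquiv_monomial u (by omega) v (mem_support_iff.mp hv)
  obtain ⟨v, hv, hmax⟩ := Finset.exists_max_image f.support (fun v => (h v).natDegree)
    (support_nonempty.mpr hf)
  have hv0 : h v ≠ 0 := by
    rw [← Polynomial.leadingCoeff_ne_zero, (hh v hv).2]
    simpa using mem_support_iff.mp hv
  have hsmall : ∀ w ∈ f.support \ {v}, (h w).degree < (h v).degree := by
    intro w hw
    obtain ⟨hw, hne⟩ := Finset.mem_sdiff.mp hw
    refine Polynomial.degree_lt_degree (lt_of_le_of_ne (hmax w hw) fun heq => hne ?_)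
    rw [(hh w hw).1, (hh v hv).1] at heq
    simpa using sum_pow_mul_injOn (by omega) (hlt w hw) (hlt v hv) heq
  have hsum : finSuccEquiv k n (nagataEquiv u f) = ∑ w ∈ f.support \ {v}, h w + h v := by
    conv_lhs => rw [← f.support_sum_monomial_coeff]
    rw [map_sum, map_sum, Finset.sum_eq_add_sum_sdiff_singleton_of_mem hv]
    exact add_comm _ _
  rw [hsum, Polynomial.leadingCoeff_add_of_degree_lt, (hh v hv).2]
  · exact (mem_support_iff.mp hv).isUnit.map C
  · refine (Polynomial.degree_sum_le _ _).trans_lt ?_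
    exact (Finset.sup_lt_iff (Ne.bot_lt fun x => hv0 (Polynomial.degree_eq_bot.mp x))).mpr hsmall

theorem VecEquiv.of_ringEquiv {S T ι : Type*} [CommRing S] [CommRing T] [Fintype ι]
    [DecidableEq ι] {f : ι → S} (e : S ≃+* T) {i : ι}
    (h : VecEquiv (fun j => e (f j)) (Pi.single i 1)) : VecEquiv f (Pi.single i 1) := by
  have h1 := h.map (e.symm : T →+* S)
  convert h1 using 1
  · ext j; simp
  · ext j
    by_cases hj : j = i
    · subst hj; simp
    · simp [hj]

theorem VecEquiv.smul {S ι : Type*} [CommRing S] [Fintype ι] [DecidableEq ι] {f g : ι → S}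
    (h : VecEquiv f g) (a : S) : VecEquiv (a • f) (a • g) := by
  obtain ⟨G, H, hGH, rfl⟩ := h
  exact ⟨G, H, hGH, Matrix.mulVec_smul _ _ _⟩

theorem IsUnimodularVec.unit_smul {S ι : Type*} [CommRing S] [Fintype ι] {f : ι → S}
    (hf : IsUnimodularVec f) {a b : S} (hab : a * b = 1) : IsUnimodularVec (b • f) := by
  obtain ⟨g, hg⟩ := hf
  exact ⟨a • g, by rw [smul_dotProduct, dotProduct_smul, hg]; simpa using hab⟩

/-- **Quillen–Suslin theorem** for unimodular vectors of length three. -/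
theorem IsUnimodularVec.vecEquiv_single {f : Fin 3 → MvPolynomial (Fin n) k}
    (hf : IsUnimodularVec f) (l : Fin 3) : VecEquiv f (Pi.single l 1) := by
  induction n with
  | zero =>
    obtain ⟨i, hi⟩ : ∃ i, f i ≠ 0 := by
      by_contra! h
      obtain ⟨g, hg⟩ := hf
      simp [dotProduct, h] at hg
    refine VecEquiv.single_of_isUnit (i := i) ?_ l
    rw [eq_C_of_isEmpty (f i)]
    refine IsUnit.map C (Ne.isUnit fun h => hi ?_)
    rw [eq_C_of_isEmpty (f i), h, C_0]
  | succ n ih =>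
    obtain ⟨i, hi⟩ : ∃ i, f i ≠ 0 := by
      by_contra! h
      obtain ⟨g, hg⟩ := hf
      simp [dotProduct, h] at hg
    obtain ⟨u, hu⟩ := exists_isUnit_leadingCoeff_nagataEquiv hi
    have h1 := hf.map ((nagataEquiv u).trans (finSuccEquiv k n)).toRingEquiv.toRingHom
    apply VecEquiv.of_ringEquiv ((nagataEquiv u).trans (finSuccEquiv k n)).toRingEquiv
    set F : Fin 3 → Polynomial (MvPolynomial (Fin n) k) :=
      fun j => finSuccEquiv k n (nagataEquiv u (f j)) with hF
    change IsUnimodularVec F at h1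
    change VecEquiv F _
    change IsUnit (F i).leadingCoeff at hu
    obtain ⟨c, hc⟩ := hu.exists_left_inv
    have hCc : Polynomial.C (F i).leadingCoeff * Polynomial.C c = 1 := by
      rw [← Polynomial.C_mul, mul_comm, hc, Polynomial.C_1]
    have h2 : IsUnimodularVec (Polynomial.C c • F) := h1.unit_smul hCc
    have hmonic : ((Polynomial.C c • F) i).Monic := by
      rw [Pi.smul_apply, smul_eq_mul, Polynomial.Monic, Polynomial.leadingCoeff_mul,
        Polynomial.leadingCoeff_C, hc]
    have h3 := (h2.vecEquiv_eval_zero hmonic).trans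
      ((ih (h2.map (Polynomial.evalRingHom 0))).map Polynomial.C)
    have h4 := h3.smul (Polynomial.C (F i).leadingCoeff)
    rw [smul_smul, hCc, one_smul] at h4
    refine h4.trans (VecEquiv.single_of_isUnit (i := l) ?_ l)
    simpa using hu.map Polynomial.C

end QuillenSuslin

section Retractions

/-- Commuting retractions `φ` and `ψ` of a ring that kill `x` and `y` respectively, and are the
identity modulo `x` and `y` respectively. -/
structure AxisRetractions {R : Type*} [CommRing R] (x y : R) (φ ψ : R →+* R) : Prop where
  comm : ∀ a, φ (ψ a) = ψ (φ a)
  left_left : ∀ a, φ (φ a) = φ a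
  right_right : ∀ a, ψ (ψ a) = ψ a
  left_x : φ x = 0
  left_y : φ y = y
  right_x : ψ x = x
  right_y : ψ y = 0
  x_dvd : ∀ a, x ∣ a - φ a
  y_dvd : ∀ a, y ∣ a - ψ a

variable {R ι : Type*} [CommRing R] [Fintype ι] [DecidableEq ι]

theorem AxisRetractions.symm {x y : R} {φ ψ : R →+* R} (h : AxisRetractions x y φ ψ) :
    AxisRetractions y x ψ φ :=
  ⟨fun a => (h.comm a).symm, h.right_right, h.left_left, h.right_y, h.right_x, h.left_y, h.left_x,
    h.y_dvd, h.x_dvd⟩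

omit [DecidableEq ι] in
theorem RingHom.comp_mulVec {S : Type*} [CommRing S] (φ : R →+* S) (M : Matrix ι ι R) (v : ι → R) :
    φ ∘ (M *ᵥ v) = M.map φ *ᵥ (φ ∘ v) :=
  funext fun i => RingHom.map_mulVec φ M v i

omit [DecidableEq ι] in
theorem RingHom.comp_dotProduct {S : Type*} [CommRing S] (φ : R →+* S) (u v : ι → R) :
    φ (u ⬝ᵥ v) = (φ ∘ u) ⬝ᵥ (φ ∘ v) := by
  simp [dotProduct]

theorem Matrix.map_mul_eq_one {S : Type*} [CommRing S] (φ : R →+* S) {G H : Matrix ι ι R}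
    (h : G * H = 1) : G.map φ * H.map φ = 1 := by
  rw [← Matrix.map_mul, h, Matrix.map_one _ (map_zero φ) (map_one φ)]

/-- Up to `t ^ N`, the matrix `A` has a constant-rank decomposition: after the change of basis `H`,
its kernel is that of a constant projection `E`. -/
def HasSplitting (A : Matrix ι ι R) (t : R) (N : ℕ) : Prop :=
  ∃ G H E B : Matrix ι ι R, ∃ w : ι → R, G * H = 1 ∧ (∀ χ : R →+* R, E.map χ = E) ∧
    E *ᵥ w = w ∧ IsUnimodularVec w ∧ A * (G * E * H) = A ∧ B * A = t ^ N • (G * E * H)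

theorem HasSplitting.exists_isUnimodularVec {A : Matrix ι ι R} {t : R} (h : HasSplitting A t 0) :
    ∃ v, IsUnimodularVec (A *ᵥ v) := by
  obtain ⟨G, H, E, B, w, hGH, -, hEw, hw, -, hB⟩ := h
  have hHG := mul_eq_one_comm.mp hGH
  refine ⟨G *ᵥ w, IsUnimodularVec.of_mulVec (G := H * B) ?_⟩
  have : H * (G * E * H * G) = E := by
    rw [Matrix.mul_assoc (G * E), hHG, Matrix.mul_one, ← Matrix.mul_assoc, hHG, Matrix.one_mul]
  rw [Matrix.mulVec_mulVec, Matrix.mul_assoc, hB, pow_zero, one_smul, Matrix.mulVec_mulVec,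
    Matrix.mul_assoc H, this, hEw]
  exact hw

omit [DecidableEq ι] in
theorem isUnimodularVec_of_pow_of_add {f g h : ι → R} {t r : R} {N : ℕ} (hg : g ⬝ᵥ f = 1 + t * r)
    (hh : h ⬝ᵥ f = t ^ N) : IsUnimodularVec f := by
  have : IsCoprime (1 + t * r) (t ^ N) := IsCoprime.pow_right ⟨1, -r, by ring⟩
  obtain ⟨a, b, hab⟩ := this
  refine ⟨a • g + b • h, ?_⟩
  rw [add_dotProduct, smul_dotProduct, smul_dotProduct, hg, hh, smul_eq_mul, smul_eq_mul, hab]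

theorem AxisRetractions.exists_extension {x y : R} {φ ψ : R →+* R} (hr : AxisRetractions x y φ ψ)
    {A : Matrix ι ι R} (hA : A.map φ = A) {N : ℕ} (h : HasSplitting A y N) {v₀ : ι → R}
    (hφ : φ ∘ v₀ = v₀) (hψ : ψ ∘ v₀ = v₀) (hv₀ : IsUnimodularVec (A.map ψ *ᵥ v₀)) :
    ∃ v, φ ∘ v = v ∧ ψ ∘ v = v₀ ∧ IsUnimodularVec (A *ᵥ v) := by
  obtain ⟨G, H, E, B, w, hGH, hE, -, -, hAP, hB⟩ := h
  wlog hG : G.map φ = G ∧ H.map φ = H generalizing G H B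
  · refine this (G.map φ) (H.map φ) (B.map φ) (Matrix.map_mul_eq_one φ hGH) ?_ ?_ ⟨?_, ?_⟩
    · have := congrArg (fun M => M.map φ) hAP
      simpa only [Matrix.map_mul, hE, hA] using this
    · have := congrArg (fun M => M.map φ) hB
      simp only [Matrix.map_mul, hA] at this
      rw [this]
      conv_rhs => rw [← hE φ, ← Matrix.map_mul, ← Matrix.map_mul]
      ext i j
      simp only [Matrix.map_apply, Matrix.smul_apply, smul_eq_mul, map_mul, map_pow, hr.left_y]
    · ext i j; simp [hr.left_left]
    · ext i j; simp [hr.left_left]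
  obtain ⟨hGφ, hHφ⟩ := hG
  have hHG := mul_eq_one_comm.mp hGH
  have hψψ : ∀ M : Matrix ι ι R, (M.map ψ).map ψ = M.map ψ := by
    intro M; ext i j; simp [hr.right_right]
  have hφψ : ∀ M : Matrix ι ι R, (M.map ψ).map φ = (M.map φ).map ψ := by
    intro M; ext i j; simp [hr.comm]
  set v := (G * H.map ψ) *ᵥ v₀ with hv
  have hψv : ψ ∘ v = v₀ := by
    rw [hv, RingHom.comp_mulVec, Matrix.map_mul, hψψ, Matrix.map_mul_eq_one ψ hGH, hψ,
      Matrix.one_mulVec]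
  refine ⟨v, ?_, hψv, ?_⟩
  · rw [hv, RingHom.comp_mulVec, Matrix.map_mul, hφψ, hGφ, hHφ, hφ]
  obtain ⟨g, hg⟩ := hv₀
  obtain ⟨r, hr'⟩ : ∃ r, (ψ ∘ g) ⬝ᵥ (A *ᵥ v) = 1 + y * r := by
    obtain ⟨r, h1⟩ := hr.y_dvd ((ψ ∘ g) ⬝ᵥ (A *ᵥ v))
    refine ⟨r, ?_⟩
    have h2 : ψ ((ψ ∘ g) ⬝ᵥ (A *ᵥ v)) = 1 := by
      have h3 := congrArg ψ hg
      rw [RingHom.comp_dotProduct, RingHom.comp_mulVec, hψψ, hψ, map_one] at h3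
      rw [RingHom.comp_dotProduct, RingHom.comp_mulVec, hψv, ← h3]
      congr 1
      ext i; simp [hr.right_right]
    rw [h2] at h1
    linear_combination h1
  refine isUnimodularVec_of_pow_of_add hr' (h := g ᵥ* (A.map ψ * G.map ψ * H * B)) (N := N) ?_
  have h4 : A.map ψ * (G.map ψ * E * H.map ψ) = A.map ψ := by
    have := congrArg (fun M => M.map ψ) hAP
    simpa only [Matrix.map_mul, hE] using this
  rw [← Matrix.dotProduct_mulVec, Matrix.mulVec_mulVec, hv, Matrix.mulVec_mulVec]
  have h5 : A.map ψ * G.map ψ * H * B * A * (G * H.map ψ) = y ^ N • A.map ψ := by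
    calc A.map ψ * G.map ψ * H * B * A * (G * H.map ψ)
        = A.map ψ * G.map ψ * H * (B * A) * (G * H.map ψ) := by simp only [Matrix.mul_assoc]
      _ = y ^ N • (A.map ψ * G.map ψ * (H * G) * E * (H * G) * H.map ψ) := by
          rw [hB]; simp only [Matrix.mul_assoc, Matrix.mul_smul, Matrix.smul_mul]
      _ = _ := by
          rw [hHG, Matrix.mul_one, Matrix.mul_one]
          conv_rhs => rw [← h4]
          simp only [Matrix.mul_assoc]
  rw [h5, Matrix.smul_mulVec, dotProduct_smul, hg, smul_eq_mul, mul_one]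

theorem AxisRetractions.exists_lift {x y : R} {φ ψ : R →+* R} (hr : AxisRetractions x y φ ψ)
    {l : ι} (hqs : ∀ f : ι → R, IsUnimodularVec f → VecEquiv f (Pi.single l 1)) {a c : ι → R}
    (ha : IsUnimodularVec a) (hc : IsUnimodularVec c) (hφa : φ ∘ a = a) (hψc : ψ ∘ c = c)
    (hac : ψ ∘ a = φ ∘ c) :
    ∃ v, IsUnimodularVec v ∧ φ ∘ v = a ∧ ψ ∘ v = c := by
  set e : ι → R := Pi.single l 1 with he
  have hχe : ∀ χ : R →+* R, χ ∘ e = e := by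
    intro χ
    ext i
    by_cases hi : i = l
    · subst hi; simp [he]
    · simp [he, hi]
  have key : ∀ (χ : R →+* R) (b : ι → R), χ ∘ b = b → IsUnimodularVec b → (∀ a, χ (χ a) = χ a) →
      ∃ P Q : Matrix ι ι R, P * Q = 1 ∧ P *ᵥ e = b ∧ P.map χ = P ∧ Q.map χ = Q := by
    intro χ b hb hbu hχ
    obtain ⟨P, Q, hPQ, hP⟩ := (hqs b hbu).symm
    refine ⟨P.map χ, Q.map χ, Matrix.map_mul_eq_one χ hPQ, ?_, ?_, ?_⟩
    · rw [← hχe χ, ← RingHom.comp_mulVec, hP, hb]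
    · ext i j; simp [hχ]
    · ext i j; simp [hχ]
  obtain ⟨P, Q, hPQ, hPe, hPφ, hQφ⟩ := key φ a hφa ha hr.left_left
  obtain ⟨P', Q', hPQ', hPe', hPψ, hQψ⟩ := key ψ c hψc hc hr.right_right
  have hψψ : ∀ M : Matrix ι ι R, (M.map ψ).map ψ = M.map ψ := by
    intro M; ext i j; simp [hr.right_right]
  have hφφ : ∀ M : Matrix ι ι R, (M.map φ).map φ = M.map φ := by
    intro M; ext i j; simp [hr.left_left]
  have hφψ : ∀ M : Matrix ι ι R, (M.map ψ).map φ = (M.map φ).map ψ := by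
    intro M; ext i j; simp [hr.comm]
  have h1 := Matrix.map_mul_eq_one φ hPQ'
  have h2 := Matrix.map_mul_eq_one ψ hPQ
  have hφv : φ ∘ ((P * Q.map ψ * P' * Q'.map φ * P.map ψ) *ᵥ e) = a := by
    rw [RingHom.comp_mulVec, hχe]
    simp only [Matrix.map_mul, hφψ, hφφ, hPφ, hQφ]
    rw [Matrix.mul_assoc (P * _), h1, Matrix.mul_one, Matrix.mul_assoc, mul_eq_one_comm.mp h2,
      Matrix.mul_one, hPe]
  have hψv : ψ ∘ ((P * Q.map ψ * P' * Q'.map φ * P.map ψ) *ᵥ e) = c := by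
    rw [RingHom.comp_mulVec, hχe]
    simp only [Matrix.map_mul, ← hφψ, hψψ, hPψ, hQψ]
    rw [h2, Matrix.one_mul, ← Matrix.mulVec_mulVec, ← hχe ψ, ← RingHom.comp_mulVec, hPe, hac,
      ← Matrix.mulVec_mulVec]
    have : Q'.map φ *ᵥ (φ ∘ c) = e := by
      rw [← RingHom.comp_mulVec, ← hPe', Matrix.mulVec_mulVec, mul_eq_one_comm.mp hPQ',
        Matrix.one_mulVec, hχe]
    rw [this, hPe']
  refine ⟨_, ?_, hφv, hψv⟩
  have heu : IsUnimodularVec e := ⟨e, by simp [he]⟩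
  refine VecEquiv.isUnimodularVec ⟨_, Q.map ψ * P'.map φ * Q' * P.map ψ * Q,
    ?_, rfl⟩ heu
  calc P * Q.map ψ * P' * Q'.map φ * P.map ψ * (Q.map ψ * P'.map φ * Q' * P.map ψ * Q)
      = P * Q.map ψ * P' * Q'.map φ * (P.map ψ * Q.map ψ) * P'.map φ * Q' * P.map ψ * Q := by
        simp only [Matrix.mul_assoc]
    _ = P * Q.map ψ * P' * (Q'.map φ * P'.map φ) * Q' * P.map ψ * Q := by
        rw [h2]; simp only [Matrix.mul_assoc, Matrix.one_mul]
    _ = P * Q.map ψ * (P' * Q') * P.map ψ * Q := by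
        rw [mul_eq_one_comm.mp h1]; simp only [Matrix.mul_assoc, Matrix.one_mul]
    _ = P * (Q.map ψ * P.map ψ) * Q := by
        rw [hPQ']; simp only [Matrix.mul_assoc, Matrix.one_mul]
    _ = 1 := by rw [mul_eq_one_comm.mp h2, Matrix.mul_one, hPQ]

/-- A matrix whose determinant is `x ^ p * y ^ q` up to a unit, with constant-rank decompositions
along both axes, maps some vector to a unimodular vector. -/
theorem AxisRetractions.exists_isUnimodularVec_mulVec {x y : R} {φ ψ : R →+* R}
    (hr : AxisRetractions x y φ ψ)
    {l : ι} (hqs : ∀ f : ι → R, IsUnimodularVec f → VecEquiv f (Pi.single l 1)) {F : Matrix ι ι R}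
    {u : R} (hu : IsUnit u) {p q : ℕ} (hdet : F.det = u * (x ^ p * y ^ q)) {N M : ℕ}
    (hx : HasSplitting (F.map φ) y N) (hy : HasSplitting (F.map ψ) x M) (hNM : N = 0 ∨ M = 0) :
    ∃ v, IsUnimodularVec (F *ᵥ v) := by
  wlog hN : N = 0 generalizing x y φ ψ p q N M
  · exact this hr.symm (p := q) (q := p) (by rw [hdet, mul_comm (x ^ p)]) hy hx hNM.symm (by tauto)
  subst hN
  have hψψ : ∀ M : Matrix ι ι R, (M.map ψ).map ψ = M.map ψ := by
    intro M; ext i j; simp [hr.right_right]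
  have hφφ : ∀ M : Matrix ι ι R, (M.map φ).map φ = M.map φ := by
    intro M; ext i j; simp [hr.left_left]
  have hφψ : ∀ M : Matrix ι ι R, (M.map ψ).map φ = (M.map φ).map ψ := by
    intro M; ext i j; simp [hr.comm]
  obtain ⟨w, hw⟩ := hx.exists_isUnimodularVec
  set v₀ : ι → R := ψ ∘ (φ ∘ w) with hv₀
  have hφ₀ : φ ∘ v₀ = v₀ := by ext i; simp [hv₀, hr.comm, hr.left_left]
  have hψ₀ : ψ ∘ v₀ = v₀ := by ext i; simp [hv₀, hr.right_right]
  have hu₀ : IsUnimodularVec ((F.map φ).map ψ *ᵥ v₀) := by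
    have h1 : IsUnimodularVec (ψ ∘ (φ ∘ (F.map φ *ᵥ w))) := (hw.map φ).map ψ
    rwa [RingHom.comp_mulVec, RingHom.comp_mulVec, hφφ] at h1
  obtain ⟨a, hφa, hψa, hua⟩ := hr.exists_extension (hφφ F) hx hφ₀ hψ₀ hu₀
  obtain ⟨c, hψc, hφc, huc⟩ := hr.symm.exists_extension (hψψ F) hy hψ₀ hφ₀ (by rwa [hφψ])
  obtain ⟨v, ⟨g, hg⟩, hφv, hψv⟩ := hr.exists_lift hqs hua.of_mulVec huc.of_mulVec hφa hψc
    (hψa.trans hφc.symm)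
  refine ⟨v, ?_⟩
  have hdetv : (g ᵥ* F.adjugate) ⬝ᵥ (F *ᵥ v) = u * (x ^ p * y ^ q) := by
    rw [← Matrix.dotProduct_mulVec, Matrix.mulVec_mulVec, Matrix.adjugate_mul, Matrix.smul_mulVec,
      Matrix.one_mulVec, dotProduct_smul, hg, hdet, smul_eq_mul, mul_one]
  have key : ∀ (χ : R →+* R) (t : R), (∀ a, χ (χ a) = χ a) → (∀ a, t ∣ a - χ a) →
      ∀ b, χ ∘ v = b → IsUnimodularVec (F.map χ *ᵥ b) → ∃ h r, h ⬝ᵥ (F *ᵥ v) = 1 + t * r := by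
    rintro χ t hχ ht b hb ⟨h, hh⟩
    obtain ⟨r, hr'⟩ := ht ((χ ∘ h) ⬝ᵥ (F *ᵥ v))
    refine ⟨χ ∘ h, r, ?_⟩
    have hb' : χ ∘ b = b := by rw [← hb]; ext i; simp [hχ]
    have h2 : χ ((χ ∘ h) ⬝ᵥ (F *ᵥ v)) = 1 := by
      have h3 := congrArg χ hh
      have h4 : (F.map χ).map χ = F.map χ := by ext i j; simp [hχ]
      rw [RingHom.comp_dotProduct, RingHom.comp_mulVec, h4, hb', map_one] at h3
      rw [RingHom.comp_dotProduct, RingHom.comp_mulVec, hb, ← h3]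
      congr 1
      ext i; simp [hχ]
    rw [h2] at hr'
    linear_combination hr'
  obtain ⟨h₁, r₁, hh₁⟩ := key φ x hr.left_left hr.x_dvd a hφv hua
  obtain ⟨h₂, r₂, hh₂⟩ := key ψ y hr.right_right hr.y_dvd c hψv huc
  obtain ⟨a', b', hab⟩ : IsCoprime (1 + x * r₁) (x ^ p) := IsCoprime.pow_right ⟨1, -r₁, by ring⟩
  obtain ⟨u', hu'⟩ := hu.exists_left_inv
  refine isUnimodularVec_of_pow_of_add hh₂ (N := q)
    (h := (y ^ q * a') • h₁ + (u' * b') • (g ᵥ* F.adjugate)) ?_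
  rw [add_dotProduct, smul_dotProduct, smul_dotProduct, hh₁, hdetv, smul_eq_mul, smul_eq_mul]
  linear_combination y ^ q * hab + b' * x ^ p * y ^ q * hu'

end Retractions

section EntryIdeal

variable {R ι : Type*} [CommRing R]

/-- The ideal generated by the entries of a square matrix. -/
def Matrix.entryIdeal (A : Matrix ι ι R) : Ideal R :=
  Ideal.span (Set.range fun ij : ι × ι => A ij.1 ij.2)

theorem Matrix.apply_mem_entryIdeal (A : Matrix ι ι R) (i j : ι) : A i j ∈ A.entryIdeal :=
  Ideal.subset_span ⟨(i, j), rfl⟩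

theorem Matrix.entryIdeal_le {A : Matrix ι ι R} {I : Ideal R} :
    A.entryIdeal ≤ I ↔ ∀ i j, A i j ∈ I := by
  rw [Matrix.entryIdeal, Ideal.span_le, Set.range_subset_iff, Prod.forall]
  rfl

theorem Matrix.entryIdeal_map {S : Type*} [CommRing S] (φ : R →+* S) (A : Matrix ι ι R) :
    (A.map φ).entryIdeal = A.entryIdeal.map φ := by
  rw [Matrix.entryIdeal, Matrix.entryIdeal, Ideal.map_span, ← Set.range_comp]
  rfl

theorem Matrix.entryIdeal_smul (c : R) (A : Matrix ι ι R) :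
    (c • A).entryIdeal = Ideal.span {c} * A.entryIdeal := by
  rw [Matrix.entryIdeal, Matrix.entryIdeal, Ideal.span_mul_span', Set.singleton_mul,
    ← Set.range_comp]
  rfl

theorem Matrix.entryIdeal_mul_mul_le [Fintype ι] (M A N : Matrix ι ι R) :
    (M * A * N).entryIdeal ≤ A.entryIdeal := by
  rw [Matrix.entryIdeal_le]
  intro i j
  simp only [Matrix.mul_apply]
  exact Ideal.sum_mem _ fun k _ => Ideal.mul_mem_right _ _ <|
    Ideal.sum_mem _ fun l _ => Ideal.mul_mem_left _ _ (A.apply_mem_entryIdeal l k)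

theorem isUnimodularVec_iff [Fintype ι] {f : ι → R} :
    IsUnimodularVec f ↔ Ideal.span (Set.range f) = ⊤ := by
  rw [Ideal.eq_top_iff_one, Ideal.mem_span_range_iff_exists_fun]
  rfl

/-- A matrix whose entries generate a nonzero principal ideal is a multiple of a matrix whose
entries generate the unit ideal. -/
theorem Matrix.exists_smul_of_entryIdeal_eq [IsDomain R] {A : Matrix ι ι R} {c : R} (hc : c ≠ 0)
    (h : A.entryIdeal = Ideal.span {c}) : ∃ B : Matrix ι ι R, A = c • B ∧ B.entryIdeal = ⊤ := by
  have h1 : ∀ i j, ∃ b, A i j = c * b := fun i j =>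
    Ideal.mem_span_singleton.mp (h ▸ A.apply_mem_entryIdeal i j)
  choose B hB using h1
  refine ⟨Matrix.of B, Matrix.ext hB, ?_⟩
  have h2 : c ∈ Ideal.span {c} * (Matrix.of B).entryIdeal := by
    rw [← Matrix.entryIdeal_smul, ← show A = c • Matrix.of B from Matrix.ext hB, h]
    exact Ideal.mem_span_singleton_self c
  obtain ⟨z, hz, hcz⟩ := Ideal.mem_span_singleton_mul.mp h2
  rw [Ideal.eq_top_iff_one]
  rwa [← mul_left_cancel₀ hc (hcz.trans (mul_one c).symm)]

/-- A matrix over a unique factorization domain whose entries generate the unit ideal and whose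
`2 × 2` minors vanish is the product of a unimodular column and a unimodular row. -/
theorem Matrix.exists_eq_vecMulVec [IsDomain R] [UniqueFactorizationMonoid R] [Fintype ι]
    {A : Matrix ι ι R} (hA : A.entryIdeal = ⊤)
    (hm : ∀ i j k l, A i j * A k l = A i l * A k j) :
    ∃ α β : ι → R, IsUnimodularVec α ∧ IsUnimodularVec β ∧ A = vecMulVec α β := by
  classical
  obtain ⟨i₀, j₁, hij⟩ : ∃ i j, A i j ≠ 0 := by
    by_contra! h
    have h0 : A.entryIdeal ≤ ⊥ := Matrix.entryIdeal_le.mpr fun i j => by simp [h i j]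
    rw [hA, top_le_iff] at h0
    exact bot_ne_top h0
  obtain ⟨_⟩ : Nonempty (NormalizedGCDMonoid R) := inferInstance
  obtain ⟨β, hβ, hβ1⟩ := Finset.extract_gcd (s := Finset.univ) (A i₀) ⟨i₀, Finset.mem_univ _⟩
  set g := Finset.univ.gcd (A i₀) with hg
  have hg0 : g ≠ 0 := fun h => hij (by rw [hβ j₁ (Finset.mem_univ _), h, zero_mul])
  have hβ0 : β j₁ ≠ 0 := fun h => hij (by rw [hβ j₁ (Finset.mem_univ _), h, mul_zero])
  have h1 : ∀ i j l, A i j * β l = A i l * β j := by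
    intro i j l
    apply mul_left_cancel₀ hg0
    have := hm i j i₀ l
    rw [hβ l (Finset.mem_univ _), hβ j (Finset.mem_univ _)] at this
    linear_combination this
  have h2 : ∀ i, β j₁ ∣ A i j₁ := by
    intro i
    have h3 : β j₁ ∣ Finset.univ.gcd fun j => A i j₁ * β j :=
      Finset.dvd_gcd fun j _ => ⟨A i j, by rw [← h1]; ring⟩
    refine h3.trans ((Finset.gcd_mul_left' _ _ _).dvd.trans ?_)
    rw [hβ1, mul_one]
  choose α hα using h2
  have h3 : A = vecMulVec α β := by
    ext i j
    apply mul_left_cancel₀ hβ0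
    rw [vecMulVec_apply, mul_comm, h1, hα]
    ring
  refine ⟨α, β, ?_, ?_, h3⟩
  · rw [isUnimodularVec_iff, eq_top_iff, ← hA, Matrix.entryIdeal_le]
    intro i j
    rw [h3, vecMulVec_apply]
    exact Ideal.mul_mem_right _ _ (Ideal.subset_span ⟨i, rfl⟩)
  · rw [isUnimodularVec_iff, eq_top_iff, ← hA, Matrix.entryIdeal_le]
    intro i j
    rw [h3, vecMulVec_apply]
    exact Ideal.mul_mem_left _ _ (Ideal.subset_span ⟨j, rfl⟩)

/-- The adjugate of a `3 × 3` matrix collects its `2 × 2` minors. -/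
theorem Matrix.minor_mem_entryIdeal_adjugate (A : Matrix (Fin 3) (Fin 3) R) (i j k l : Fin 3) :
    A i j * A k l - A i l * A k j ∈ A.adjugate.entryIdeal := by
  have h : ∀ i j, A.adjugate i j ∈ A.adjugate.entryIdeal := A.adjugate.apply_mem_entryIdeal
  have h' : ∀ i j, -A.adjugate i j ∈ A.adjugate.entryIdeal := fun i j => neg_mem (h i j)
  have key : A i j * A k l - A i l * A k j = 0 ∨
      ∃ i' j', A i j * A k l - A i l * A k j = A.adjugate i' j' ∨
        A i j * A k l - A i l * A k j = -A.adjugate i' j' := by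
    by_cases hik : i = k
    · left; subst hik; ring
    by_cases hjl : j = l
    · left; subst hjl; ring
    right
    obtain ⟨m, hm⟩ : ∃ m : Fin 3, m ≠ i ∧ m ≠ k := by decide +revert
    obtain ⟨n, hn⟩ : ∃ m : Fin 3, m ≠ j ∧ m ≠ l := by decide +revert
    refine ⟨n, m, ?_⟩
    rw [Matrix.adjugate_fin_three]
    fin_cases i <;> fin_cases k <;> first | exact absurd rfl hik | skip
    all_goals fin_cases j <;> fin_cases l <;> first | exact absurd rfl hjl | skip
    all_goals fin_cases m <;> fin_cases n <;> simp at hm hn ⊢ <;>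
      first | (left; ring1) | (right; ring1)
  obtain h0 | ⟨i', j', h0 | h0⟩ := key
  · rw [h0]; exact zero_mem _
  · rw [h0]; exact h _ _
  · rw [h0]; exact h' _ _

end EntryIdeal

section Splitting

variable {R ι : Type*} [CommRing R] [Fintype ι] [DecidableEq ι]

theorem HasSplitting.of_det {A : Matrix ι ι R} {u t : R} {N : ℕ} (l : ι) (hu : IsUnit u)
    (h : A.det = u * t ^ N) : HasSplitting A t N := by
  obtain ⟨u', hu'⟩ := hu.exists_left_inv
  refine ⟨1, 1, 1, u' • A.adjugate, Pi.single l 1, by simp, fun χ => ?_, Matrix.one_mulVec _,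
    ⟨Pi.single l 1, by simp⟩, by simp, ?_⟩
  · exact Matrix.map_one _ (map_zero χ) (map_one χ)
  · rw [Matrix.smul_mul, Matrix.adjugate_mul, h, smul_smul, ← mul_assoc, hu']
    simp

omit [Fintype ι] in
theorem Matrix.map_vecMulVec_single {S : Type*} [CommRing S] (χ : R →+* S) (l : ι) :
    (vecMulVec (Pi.single l 1 : ι → R) (Pi.single l 1 : ι → R)).map χ =
      vecMulVec (Pi.single l 1) (Pi.single l 1) := by
  ext i j
  by_cases hi : i = l <;> by_cases hj : j = l <;> simp [vecMulVec_apply, hi, hj]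

theorem HasSplitting.of_vecMulVec {α β : ι → R} (hα : IsUnimodularVec α) (t : R) {l : ι}
    (hβ : VecEquiv β (Pi.single l 1)) : HasSplitting (vecMulVec α β) t 0 := by
  obtain ⟨a, ha⟩ := hα
  obtain ⟨G, H, hGH, hG⟩ := hβ
  have hGH' : Gᵀ * Hᵀ = 1 := by
    rw [← Matrix.transpose_mul, mul_eq_one_comm.mp hGH, Matrix.transpose_one]
  have hβG : β ᵥ* Gᵀ = Pi.single l 1 := by rw [Matrix.vecMul_transpose, hG]
  have hβH : Pi.single l 1 ᵥ* Hᵀ = β := by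
    rw [← hβG, Matrix.vecMul_vecMul, hGH', Matrix.vecMul_one]
  have hP : Gᵀ * vecMulVec (Pi.single l 1) (Pi.single l 1) * Hᵀ =
      vecMulVec (Gᵀ *ᵥ Pi.single l 1) β := by
    rw [Matrix.mul_vecMulVec, Matrix.vecMulVec_mul, hβH]
  refine ⟨Gᵀ, Hᵀ, vecMulVec (Pi.single l 1) (Pi.single l 1), vecMulVec (Gᵀ *ᵥ Pi.single l 1) a,
    Pi.single l 1, hGH', fun χ => Matrix.map_vecMulVec_single χ l, ?_, ⟨Pi.single l 1, by simp⟩,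
    ?_, ?_⟩
  · rw [Matrix.vecMulVec_mulVec]; simp
  · rw [hP, Matrix.vecMulVec_mul_vecMulVec, Matrix.dotProduct_mulVec, hβG]; simp
  · rw [hP, Matrix.vecMulVec_mul_vecMulVec, ha]; simp

theorem HasSplitting.of_adjugate_eq {A : Matrix (Fin 3) (Fin 3) R} {t : R} {N : ℕ}
    {s w : Fin 3 → R} (hdet : A.det = 0) (hadj : A.adjugate = t ^ N • vecMulVec s w)
    (hAs : A *ᵥ s = 0) (hw : IsUnimodularVec w)
    (hs : VecEquiv s (Pi.single 0 1)) : HasSplitting A t N := by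
  obtain ⟨G, H, hGH, hG⟩ := hs
  have hHG := mul_eq_one_comm.mp hGH
  obtain ⟨τ, hτ⟩ := hw
  have hHs : H *ᵥ Pi.single 0 1 = s := by
    rw [← hG, Matrix.mulVec_mulVec, hHG, Matrix.one_mulVec]
  set σ : Fin 3 → R := Pi.single 0 1 ᵥ* G with hσ
  have hσs : σ ⬝ᵥ s = 1 := by rw [hσ, ← Matrix.dotProduct_mulVec, hG]; simp
  have hP : H * (1 - vecMulVec (Pi.single 0 1) (Pi.single 0 1)) * G = 1 - vecMulVec s σ := by
    rw [Matrix.mul_sub, Matrix.sub_mul, Matrix.mul_one, hHG, Matrix.mul_vecMulVec,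
      Matrix.vecMulVec_mul, hHs]
  have hd : (A + vecMulVec τ σ).det = t ^ N := by
    have h1 : (A + vecMulVec τ σ).det = A.det + σ ⬝ᵥ (A.adjugate *ᵥ τ) := by
      rw [Matrix.adjugate_fin_three, Matrix.det_fin_three, Matrix.det_fin_three]
      simp [dotProduct, Matrix.mulVec, Fin.sum_univ_three, vecMulVec_apply]
      ring
    rw [h1, hdet, hadj, Matrix.smul_mulVec, Matrix.vecMulVec_mulVec, dotProduct_comm w τ, hτ]
    simp [hσs]
  set B := (A + vecMulVec τ σ).adjugate with hB
  have hBA : B * (A + vecMulVec τ σ) = t ^ N • 1 := by rw [hB, Matrix.adjugate_mul, hd]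
  have hBτ : B *ᵥ τ = t ^ N • s := by
    have h1 : (A + vecMulVec τ σ) *ᵥ s = τ := by
      rw [Matrix.add_mulVec, hAs, Matrix.vecMulVec_mulVec, hσs]; simp
    rw [← h1, Matrix.mulVec_mulVec, hBA, Matrix.smul_mulVec, Matrix.one_mulVec]
  refine ⟨H, G, 1 - vecMulVec (Pi.single 0 1) (Pi.single 0 1), B, Pi.single 1 1, hHG, fun χ => ?_,
    ?_, ⟨Pi.single 1 1, by simp⟩, ?_, ?_⟩
  · rw [Matrix.map_sub χ (map_sub χ), Matrix.map_vecMulVec_single,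
      Matrix.map_one _ (map_zero χ) (map_one χ)]
  · rw [Matrix.sub_mulVec, Matrix.vecMulVec_mulVec, Matrix.one_mulVec]; simp
  · rw [hP, Matrix.mul_sub, Matrix.mul_vecMulVec, hAs]; simp
  · rw [hP]
    have h2 : B * A = B * (A + vecMulVec τ σ) - vecMulVec (B *ᵥ τ) σ := by
      rw [Matrix.mul_add, Matrix.mul_vecMulVec, add_sub_cancel_right]
    rw [h2, hBA, hBτ, Matrix.smul_vecMulVec, smul_sub]

variable [IsDomain R] [UniqueFactorizationMonoid R]

theorem HasSplitting.of_minors_eq_zero {l : ι}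
    (hqs : ∀ f : ι → R, IsUnimodularVec f → VecEquiv f (Pi.single l 1)) {A : Matrix ι ι R}
    (hA : A.entryIdeal = ⊤) (hm : ∀ i j k l, A i j * A k l = A i l * A k j) (t : R) :
    HasSplitting A t 0 := by
  obtain ⟨α, β, hα, hβ, rfl⟩ := Matrix.exists_eq_vecMulVec hA hm
  exact HasSplitting.of_vecMulVec hα t (hqs β hβ)

theorem Matrix.mul_apply_eq_of_adjugate_eq_zero {S : Type*} [CommRing S]
    {A : Matrix (Fin 3) (Fin 3) S}
    (h : A.adjugate = 0) (i j k l : Fin 3) : A i j * A k l = A i l * A k j := by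
  have h1 := A.minor_mem_entryIdeal_adjugate i j k l
  have h2 : A.adjugate.entryIdeal ≤ ⊥ := Matrix.entryIdeal_le.mpr fun i j => by simp [h]
  exact sub_eq_zero.mp (h2 h1)

theorem HasSplitting.of_det_eq_zero
    (hqs : ∀ f : Fin 3 → R, IsUnimodularVec f → VecEquiv f (Pi.single 0 1))
    {A : Matrix (Fin 3) (Fin 3) R} {t : R} {N : ℕ} (ht : t ≠ 0)
    (hdet : A.det = 0) (hA : A.adjugate.entryIdeal = Ideal.span {t ^ N}) :
    HasSplitting A t N := by
  have htN := pow_ne_zero N ht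
  obtain ⟨B, hB, hB'⟩ := Matrix.exists_smul_of_entryIdeal_eq htN hA
  have hBadj : B.adjugate = 0 := by
    have h1 : A.adjugate.adjugate = 0 := by
      rw [Matrix.adjugate_adjugate _ (by simp), hdet]; simp
    rw [hB, Matrix.adjugate_smul] at h1
    exact (smul_eq_zero.mp h1).resolve_left (pow_ne_zero _ htN)
  obtain ⟨s, w, hs, hw, rfl⟩ :=
    Matrix.exists_eq_vecMulVec hB' (Matrix.mul_apply_eq_of_adjugate_eq_zero hBadj)
  refine HasSplitting.of_adjugate_eq hdet hB ?_ hw (hqs s hs)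
  have h2 : A * A.adjugate = 0 := by rw [Matrix.mul_adjugate, hdet, zero_smul]
  rw [hB, Matrix.mul_smul, smul_eq_zero, or_iff_right htN, Matrix.mul_vecMulVec] at h2
  obtain ⟨τ, hτ⟩ := hw
  have h3 : vecMulVec (A *ᵥ s) w *ᵥ τ = 0 := by rw [h2, Matrix.zero_mulVec]
  rw [Matrix.vecMulVec_mulVec, dotProduct_comm, hτ] at h3
  simpa using h3

end Splitting

section MatEquiv

variable {R : Type*} [CommRing R] {m : ℕ}

theorem Matrix.isUnit_det_of_mul_eq_one {G H : Matrix (Fin m) (Fin m) R} (h : G * H = 1) :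
    IsUnit G.det :=
  IsUnit.of_mul_eq_one H.det (by rw [← Matrix.det_mul, h, Matrix.det_one])

theorem MatEquiv.trans {F G H : Matrix (Fin m) (Fin m) R} (h₁ : MatEquiv F G)
    (h₂ : MatEquiv G H) : MatEquiv F H := by
  obtain ⟨M, N, hM, hN, rfl⟩ := h₁
  obtain ⟨M', N', hM', hN', rfl⟩ := h₂
  refine ⟨M' * M, N * N', ?_, ?_, by simp only [Matrix.mul_assoc]⟩
  · rw [Matrix.det_mul]; exact hM'.mul hM
  · rw [Matrix.det_mul]; exact hN.mul hN'

theorem MatEquiv.symm {F G : Matrix (Fin m) (Fin m) R} (h : MatEquiv F G) : MatEquiv G F := by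
  obtain ⟨M, N, hM, hN, rfl⟩ := h
  refine ⟨M⁻¹, N⁻¹, Matrix.isUnit_nonsing_inv_det M hM, Matrix.isUnit_nonsing_inv_det N hN, ?_⟩
  rw [Matrix.mul_assoc, Matrix.mul_nonsing_inv_cancel_right _ _ hN,
    Matrix.nonsing_inv_mul_cancel_left _ _ hM]

theorem MatEquiv.smul {F G : Matrix (Fin m) (Fin m) R} (h : MatEquiv F G) (c : R) :
    MatEquiv (c • F) (c • G) := by
  obtain ⟨M, N, hM, hN, rfl⟩ := h
  exact ⟨M, N, hM, hN, by rw [Matrix.mul_smul, Matrix.smul_mul]⟩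

theorem MatEquiv.entryIdeal_eq {F G : Matrix (Fin m) (Fin m) R} (h : MatEquiv F G) :
    F.entryIdeal = G.entryIdeal := by
  have key : ∀ {F G : Matrix (Fin m) (Fin m) R}, MatEquiv F G → G.entryIdeal ≤ F.entryIdeal := by
    rintro F G ⟨M, N, -, -, rfl⟩
    exact Matrix.entryIdeal_mul_mul_le M F N
  exact le_antisymm (key h.symm) (key h)

theorem MatEquiv.adjugate {F G : Matrix (Fin m) (Fin m) R} (h : MatEquiv F G) :
    MatEquiv F.adjugate G.adjugate := by
  obtain ⟨M, N, hM, hN, rfl⟩ := h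
  refine ⟨N.adjugate, M.adjugate, ?_, ?_, ?_⟩
  · rw [Matrix.det_adjugate]; exact hN.pow _
  · rw [Matrix.det_adjugate]; exact hM.pow _
  · rw [Matrix.adjugate_mul_distrib, Matrix.adjugate_mul_distrib, Matrix.mul_assoc]

theorem MatEquiv.associated_det {F G : Matrix (Fin m) (Fin m) R} (h : MatEquiv F G) :
    Associated F.det G.det := by
  obtain ⟨M, N, hM, hN, rfl⟩ := h
  refine ⟨hM.unit * hN.unit, ?_⟩
  simp only [Units.val_mul, IsUnit.unit_spec, Matrix.det_mul]
  ring

/-- If `F *ᵥ v` is unimodular, then `F` is equivalent to a matrix that splits off a unit. -/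
theorem exists_matEquiv_of_isUnimodularVec {l : Fin m}
    (hqs : ∀ f : Fin m → R, IsUnimodularVec f → VecEquiv f (Pi.single l 1))
    {F : Matrix (Fin m) (Fin m) R} {v : Fin m → R} (hv : IsUnimodularVec (F *ᵥ v)) :
    ∃ A, MatEquiv F A ∧ A *ᵥ Pi.single l 1 = Pi.single l 1 ∧
      Pi.single l 1 ᵥ* A = Pi.single l 1 := by
  obtain ⟨G, H, hGH, hG⟩ := hqs _ hv
  obtain ⟨G', H', hGH', hG'⟩ := (hqs _ hv.of_mulVec).symm
  set e : Fin m → R := Pi.single l 1 with he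
  have hee : e ⬝ᵥ e = 1 := by simp [he]
  set C := G * F * G' with hC
  have hCe : C *ᵥ e = e := by
    rw [hC, ← Matrix.mulVec_mulVec, hG', ← Matrix.mulVec_mulVec, hG]
  set r := e ᵥ* C - e with hr
  have hre : r ⬝ᵥ e = 0 := by
    rw [hr, sub_dotProduct, ← Matrix.dotProduct_mulVec, hCe, hee, sub_self]
  have hN : (1 - vecMulVec e r) * (1 + vecMulVec e r) = 1 := by
    rw [Matrix.mul_add, Matrix.mul_one, Matrix.sub_mul, Matrix.vecMulVec_mul_vecMulVec, hre]
    simp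
  refine ⟨C * (1 - vecMulVec e r), ⟨G, G' * (1 - vecMulVec e r),
    Matrix.isUnit_det_of_mul_eq_one hGH, ?_, by simp only [hC, Matrix.mul_assoc]⟩, ?_, ?_⟩
  · rw [Matrix.det_mul]
    exact (Matrix.isUnit_det_of_mul_eq_one hGH').mul (Matrix.isUnit_det_of_mul_eq_one hN)
  · rw [← Matrix.mulVec_mulVec, Matrix.sub_mulVec, Matrix.vecMulVec_mulVec, hre]
    simp [hCe]
  · rw [Matrix.mul_sub, Matrix.mul_one, Matrix.mul_vecMulVec, hCe, Matrix.vecMul_sub,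
      Matrix.vecMul_vecMulVec, hee, one_smul, hr]
    simp

theorem IsUnimodularVec.vecEquiv_single_fin_two {f : Fin 2 → R} (hf : IsUnimodularVec f) :
    VecEquiv f (Pi.single 0 1) := by
  obtain ⟨g, hg⟩ := hf
  rw [dotProduct, Fin.sum_univ_two] at hg
  refine ⟨!![g 0, g 1; -f 1, f 0], !![f 0, -g 1; f 1, g 0], ?_, ?_⟩
  · ext i j
    fin_cases i <;> fin_cases j <;> simp [Matrix.mul_apply, Fin.sum_univ_two]
    · exact hg
    · ring
    · ring
    · linear_combination hg
  · ext i
    fin_cases i <;> simp [Matrix.mulVec, dotProduct, Fin.sum_univ_two]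
    · exact hg
    · ring

/-- The block diagonal matrix with blocks `c` and `B`. -/
def Matrix.consDiagonal (c : R) (B : Matrix (Fin 2) (Fin 2) R) : Matrix (Fin 3) (Fin 3) R :=
  !![c, 0, 0; 0, B 0 0, B 0 1; 0, B 1 0, B 1 1]

theorem Matrix.consDiagonal_mul (c c' : R) (B B' : Matrix (Fin 2) (Fin 2) R) :
    consDiagonal c B * consDiagonal c' B' = consDiagonal (c * c') (B * B') := by
  ext i j
  fin_cases i <;> fin_cases j <;>
    simp [consDiagonal, Matrix.mul_apply, Fin.sum_univ_three, Fin.sum_univ_two]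

theorem Matrix.det_consDiagonal (c : R) (B : Matrix (Fin 2) (Fin 2) R) :
    (consDiagonal c B).det = c * B.det := by
  rw [Matrix.det_fin_three, Matrix.det_fin_two]
  simp [consDiagonal]
  ring

theorem MatEquiv.consDiagonal {B B' : Matrix (Fin 2) (Fin 2) R} (h : MatEquiv B B') (c : R) :
    MatEquiv (consDiagonal c B) (consDiagonal c B') := by
  obtain ⟨M, N, hM, hN, rfl⟩ := h
  refine ⟨Matrix.consDiagonal 1 M, Matrix.consDiagonal 1 N, ?_, ?_, ?_⟩
  · rwa [Matrix.det_consDiagonal, one_mul]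
  · rwa [Matrix.det_consDiagonal, one_mul]
  · rw [Matrix.consDiagonal_mul, Matrix.consDiagonal_mul, one_mul, mul_one]

theorem Matrix.entryIdeal_adjugate_consDiagonal (B : Matrix (Fin 2) (Fin 2) R) :
    (consDiagonal 1 B).adjugate.entryIdeal = B.entryIdeal := by
  have hB := B.apply_mem_entryIdeal
  have hA := (consDiagonal 1 B).adjugate.apply_mem_entryIdeal
  apply le_antisymm
  · rw [Matrix.entryIdeal_le]
    intro i j
    rw [Matrix.adjugate_fin_three]
    fin_cases i <;> fin_cases j <;> simp [consDiagonal, hB]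
    exact sub_mem (Ideal.mul_mem_right _ _ (hB _ _)) (Ideal.mul_mem_right _ _ (hB _ _))
  · rw [Matrix.entryIdeal_le]
    have h11 := hA 1 1
    have h12 := hA 1 2
    have h21 := hA 2 1
    have h22 := hA 2 2
    rw [Matrix.adjugate_fin_three] at h11 h12 h21 h22
    intro i j
    fin_cases i <;> fin_cases j
    · simpa [consDiagonal, Matrix.adjugate_fin_three] using h22
    · simpa [consDiagonal, Matrix.adjugate_fin_three] using h12
    · simpa [consDiagonal, Matrix.adjugate_fin_three] using h21
    · simpa [consDiagonal, Matrix.adjugate_fin_three] using h11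

end MatEquiv

section AxisSmith

variable {R : Type*} [CommRing R] [IsDomain R] [UniqueFactorizationMonoid R] {x y : R}
  {φ ψ : R →+* R}

theorem AxisRetractions.hasSplitting_fin_two (hr : AxisRetractions x y φ ψ)
    {F : Matrix (Fin 2) (Fin 2) R} (hF : F.entryIdeal = ⊤) {u : R} (hu : IsUnit u) {p q : ℕ}
    (hdet : F.det = u * (x ^ p * y ^ q)) :
    HasSplitting (F.map φ) y (if 0 < p then 0 else q) := by
  have hd : (F.map φ).det = φ u * (0 ^ p * y ^ q) := by
    have := RingHom.map_det φ F
    rw [RingHom.mapMatrix_apply] at this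
    rw [← this, hdet, map_mul, map_mul, map_pow, map_pow, hr.left_x, hr.left_y]
  split_ifs with hp
  · rw [zero_pow hp.ne', zero_mul, mul_zero, Matrix.det_fin_two] at hd
    refine HasSplitting.of_minors_eq_zero (fun f hf => hf.vecEquiv_single_fin_two)
      (by rw [Matrix.entryIdeal_map, hF, Ideal.map_top]) (fun i j k l => ?_) y
    fin_cases i <;> fin_cases j <;> fin_cases k <;> fin_cases l <;> simp at hd ⊢ <;>
      first | ring1 | linear_combination hd | linear_combination -hd
  · obtain rfl : p = 0 := by omega
    exact HasSplitting.of_det 0 (hu.map φ) (by simpa using hd)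

theorem AxisRetractions.hasSplitting_fin_three (hr : AxisRetractions x y φ ψ) (hy : y ≠ 0)
    (hqs : ∀ f : Fin 3 → R, IsUnimodularVec f → VecEquiv f (Pi.single 0 1))
    {F : Matrix (Fin 3) (Fin 3) R} (hF : F.entryIdeal = ⊤) {a b : ℕ}
    (hadj : F.adjugate.entryIdeal = Ideal.span {x ^ a * y ^ b}) {u : R} (hu : IsUnit u) {p q : ℕ}
    (hdet : F.det = u * (x ^ p * y ^ q)) :
    HasSplitting (F.map φ) y (if 0 < a then 0 else if 0 < p then b else q) := by
  have hd : (F.map φ).det = φ u * (0 ^ p * y ^ q) := by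
    have := RingHom.map_det φ F
    rw [RingHom.mapMatrix_apply] at this
    rw [← this, hdet, map_mul, map_mul, map_pow, map_pow, hr.left_x, hr.left_y]
  have ha : (F.map φ).adjugate.entryIdeal = Ideal.span {0 ^ a * y ^ b} := by
    have := RingHom.map_adjugate φ F
    rw [RingHom.mapMatrix_apply, RingHom.mapMatrix_apply] at this
    rw [← this, Matrix.entryIdeal_map, hadj, Ideal.map_span, Set.image_singleton, map_mul, map_pow,
      map_pow, hr.left_x, hr.left_y]
  split_ifs with ha0 hp
  · rw [zero_pow ha0.ne', zero_mul, Ideal.span_singleton_zero, ← le_bot_iff,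
      Matrix.entryIdeal_le] at ha
    exact HasSplitting.of_minors_eq_zero hqs (by rw [Matrix.entryIdeal_map, hF, Ideal.map_top])
      (Matrix.mul_apply_eq_of_adjugate_eq_zero (Matrix.ext ha)) y
  · obtain rfl : a = 0 := by omega
    refine HasSplitting.of_det_eq_zero hqs hy ?_ (by simpa using ha)
    rw [hd, zero_pow hp.ne', zero_mul, mul_zero]
  · obtain rfl : p = 0 := by omega
    exact HasSplitting.of_det 0 (hu.map φ) (by simpa using hd)

theorem AxisRetractions.matEquiv_fin_two (hr : AxisRetractions x y φ ψ)
    {F : Matrix (Fin 2) (Fin 2) R} (hF : F.entryIdeal = ⊤) {p q : ℕ}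
    (hdet : Associated F.det (x ^ p * y ^ q)) :
    MatEquiv F !![1, 0; 0, x ^ p * y ^ q] := by
  obtain ⟨u, hu⟩ := hdet.symm
  rw [mul_comm] at hu
  have hqs : ∀ f : Fin 2 → R, IsUnimodularVec f → VecEquiv f (Pi.single 0 1) :=
    fun f hf => hf.vecEquiv_single_fin_two
  obtain ⟨v, hv⟩ := hr.exists_isUnimodularVec_mulVec hqs u.isUnit hu.symm
    (hr.hasSplitting_fin_two hF u.isUnit hu.symm)
    (hr.symm.hasSplitting_fin_two hF u.isUnit (by rw [← hu, mul_comm (y ^ q)]))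
    (by split_ifs <;> omega)
  obtain ⟨A, hFA, hA, hA'⟩ := exists_matEquiv_of_isUnimodularVec hqs hv
  refine hFA.trans ?_
  have h00 : A 0 0 = 1 := by simpa using congrFun hA 0
  have h10 : A 1 0 = 0 := by simpa using congrFun hA 1
  have h01 : A 0 1 = 0 := by simpa using congrFun hA' 1
  obtain ⟨w, hw⟩ := hFA.symm.associated_det.trans hdet
  rw [Matrix.det_fin_two, h00, h01, one_mul, zero_mul, sub_zero] at hw
  refine ⟨1, !![1, 0; 0, (w : R)], by simp, by simp [Matrix.det_fin_two], ?_⟩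
  rw [Matrix.one_mul, ← hw]
  ext i j
  fin_cases i <;> fin_cases j <;> simp [Matrix.mul_apply, Fin.sum_univ_two, h00, h10, h01]

theorem AxisRetractions.exists_consDiagonal (hr : AxisRetractions x y φ ψ) (hx : x ≠ 0)
    (hy : y ≠ 0)
    (hqs : ∀ f : Fin 3 → R, IsUnimodularVec f → VecEquiv f (Pi.single 0 1))
    {F : Matrix (Fin 3) (Fin 3) R} (hF : F.entryIdeal = ⊤) {a b : ℕ}
    (hadj : F.adjugate.entryIdeal = Ideal.span {x ^ a * y ^ b}) {p q : ℕ}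
    (hdet : Associated F.det (x ^ p * y ^ q)) :
    ∃ B, MatEquiv F (consDiagonal 1 B) := by
  obtain ⟨u, hu⟩ := hdet.symm
  rw [mul_comm] at hu
  obtain ⟨v, hv⟩ := hr.exists_isUnimodularVec_mulVec hqs u.isUnit hu.symm
    (hr.hasSplitting_fin_three hy hqs hF hadj u.isUnit hu.symm)
    (hr.symm.hasSplitting_fin_three hx hqs hF (by rw [hadj, mul_comm (x ^ a)]) u.isUnit
      (by rw [← hu, mul_comm (y ^ q)]))
    (by split_ifs <;> omega)
  obtain ⟨A, hFA, hA, hA'⟩ := exists_matEquiv_of_isUnimodularVec hqs hv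
  refine ⟨!![A 1 1, A 1 2; A 2 1, A 2 2], ?_⟩
  convert hFA
  have h1 : ∀ i, A i 0 = Pi.single (M := fun _ => R) 0 1 i := fun i => by
    simpa using congrFun hA i
  have h2 : ∀ j, A 0 j = Pi.single (M := fun _ => R) 0 1 j := fun j => by
    simpa using congrFun hA' j
  ext i j
  fin_cases i <;> fin_cases j <;> simp [consDiagonal, h1, h2]

omit [UniqueFactorizationMonoid R] in
/-- Divisibility between monomials in `x` and `y` is componentwise. -/
theorem AxisRetractions.le_of_dvd (hr : AxisRetractions x y φ ψ) (hx : x ≠ 0) (hy : y ≠ 0)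
    {a b c d : ℕ} (h : x ^ a * y ^ b ∣ x ^ c * y ^ d) : a ≤ c ∧ b ≤ d := by
  have key : ∀ {x y : R} {φ ψ : R →+* R}, AxisRetractions x y φ ψ → x ≠ 0 → y ≠ 0 →
      ∀ {a c d : ℕ}, x ^ a ∣ x ^ c * y ^ d → a ≤ c := by
    intro x y φ ψ hr hx hy a c d h
    by_contra! hlt
    obtain ⟨k, rfl⟩ := Nat.exists_eq_add_of_lt hlt
    rw [add_assoc, pow_add] at h
    have h1 := map_dvd φ ((mul_dvd_mul_iff_left (pow_ne_zero c hx)).mp h)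
    rw [map_pow, map_pow, hr.left_x, hr.left_y, zero_pow (by omega), zero_dvd_iff] at h1
    exact pow_ne_zero d hy h1
  exact ⟨key hr hx hy ((dvd_mul_right _ _).trans h),
    key hr.symm hy hx ((dvd_mul_left _ _).trans (by rwa [mul_comm (y ^ d) (x ^ c)]))⟩

/-- A `3 × 3` matrix all of whose determinantal ideals are generated by monomials in `x` and `y`
is equivalent to its Smith form. -/
theorem AxisRetractions.matEquiv_fin_three (hr : AxisRetractions x y φ ψ) (hx : x ≠ 0)
    (hy : y ≠ 0)
    (hqs : ∀ f : Fin 3 → R, IsUnimodularVec f → VecEquiv f (Pi.single 0 1))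
    {F : Matrix (Fin 3) (Fin 3) R} {p₁ q₁ p₂ q₂ p₃ q₃ : ℕ}
    (h₁ : F.entryIdeal = Ideal.span {x ^ p₁ * y ^ q₁})
    (h₂ : F.adjugate.entryIdeal = Ideal.span {x ^ p₂ * y ^ q₂})
    (h₃ : Associated F.det (x ^ p₃ * y ^ q₃)) :
    ∃ a b c d, p₂ = 2 * p₁ + a ∧ q₂ = 2 * q₁ + b ∧ p₃ = 3 * p₁ + 2 * a + c ∧
      q₃ = 3 * q₁ + 2 * b + d ∧
      MatEquiv F (diagonal ![x ^ p₁ * y ^ q₁, x ^ (p₁ + a) * y ^ (q₁ + b),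
        x ^ (p₁ + a + c) * y ^ (q₁ + b + d)]) := by
  have hm : ∀ a b, x ^ a * y ^ b ≠ 0 := fun a b => mul_ne_zero (pow_ne_zero a hx) (pow_ne_zero b hy)
  obtain ⟨F₁, hF, hF₁⟩ := Matrix.exists_smul_of_entryIdeal_eq (hm p₁ q₁) h₁
  have hadj : x ^ (2 * p₁) * y ^ (2 * q₁) ∣ x ^ p₂ * y ^ q₂ := by
    rw [← Ideal.span_singleton_le_span_singleton, ← h₂, Matrix.entryIdeal_le]
    intro i j
    rw [hF, Matrix.adjugate_smul, Ideal.mem_span_singleton]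
    refine ⟨F₁.adjugate i j, ?_⟩
    simp only [Matrix.smul_apply, smul_eq_mul, Fintype.card_fin]
    ring
  obtain ⟨hle₁, hle₂⟩ := hr.le_of_dvd hx hy hadj
  obtain ⟨a, rfl⟩ := Nat.exists_eq_add_of_le hle₁
  obtain ⟨b, rfl⟩ := Nat.exists_eq_add_of_le hle₂
  have h₂' : F₁.adjugate.entryIdeal = Ideal.span {x ^ a * y ^ b} := by
    rw [hF, Matrix.adjugate_smul, Matrix.entryIdeal_smul, Fintype.card_fin] at h₂
    have h3 : Ideal.span {(x ^ p₁ * y ^ q₁) ^ (3 - 1)} * F₁.adjugate.entryIdeal =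
        Ideal.span {(x ^ p₁ * y ^ q₁) ^ (3 - 1)} * Ideal.span {x ^ a * y ^ b} := by
      rw [h₂, Ideal.span_singleton_mul_span_singleton]
      congr 2
      ring
    exact (Ideal.span_singleton_mul_right_inj (pow_ne_zero _ (hm _ _))).mp h3
  have hdet : F.det = x ^ (3 * p₁) * y ^ (3 * q₁) * F₁.det := by
    rw [hF, Matrix.det_smul, Fintype.card_fin]
    ring
  have hle : x ^ (3 * p₁) * y ^ (3 * q₁) ∣ x ^ p₃ * y ^ q₃ :=
    (Dvd.intro _ hdet.symm).trans h₃.dvd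
  obtain ⟨hle₁, hle₂⟩ := hr.le_of_dvd hx hy hle
  obtain ⟨s, rfl⟩ := Nat.exists_eq_add_of_le hle₁
  obtain ⟨t, rfl⟩ := Nat.exists_eq_add_of_le hle₂
  have h₃' : Associated F₁.det (x ^ s * y ^ t) := by
    refine Associated.of_mul_left (a := x ^ (3 * p₁) * y ^ (3 * q₁)) ?_ (Associated.refl _)
      (hm _ _)
    have e : x ^ (3 * p₁) * y ^ (3 * q₁) * (x ^ s * y ^ t) =
        x ^ (3 * p₁ + s) * y ^ (3 * q₁ + t) := by ring
    rwa [← hdet, e]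
  obtain ⟨B, hB⟩ := hr.exists_consDiagonal hx hy hqs hF₁ h₂' h₃'
  have hBe : B.entryIdeal = Ideal.span {x ^ a * y ^ b} := by
    rw [← h₂', hB.adjugate.entryIdeal_eq, Matrix.entryIdeal_adjugate_consDiagonal]
  obtain ⟨C, hC, hCe⟩ := Matrix.exists_smul_of_entryIdeal_eq (hm a b) hBe
  have hdetC : Associated (x ^ (2 * a) * y ^ (2 * b) * C.det) (x ^ s * y ^ t) := by
    have := hB.symm.associated_det.trans h₃'
    rw [Matrix.det_consDiagonal, hC, Matrix.det_smul, Fintype.card_fin, one_mul] at this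
    convert this using 1
    ring
  obtain ⟨hle₁, hle₂⟩ := hr.le_of_dvd hx hy ((dvd_mul_right _ _).trans hdetC.dvd)
  obtain ⟨c, rfl⟩ := Nat.exists_eq_add_of_le hle₁
  obtain ⟨d, rfl⟩ := Nat.exists_eq_add_of_le hle₂
  have hCd : Associated C.det (x ^ c * y ^ d) := by
    refine Associated.of_mul_left (a := x ^ (2 * a) * y ^ (2 * b)) ?_ (Associated.refl _)
      (hm _ _)
    have e : x ^ (2 * a) * y ^ (2 * b) * (x ^ c * y ^ d) =
        x ^ (2 * a + c) * y ^ (2 * b + d) := by ring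
    rwa [e]
  refine ⟨a, b, c, d, rfl, rfl, by ring, by ring, ?_⟩
  have h4 := ((hr.matEquiv_fin_two hCe hCd).smul (x ^ a * y ^ b)).consDiagonal 1
  rw [← hC] at h4
  have h5 := (hB.trans h4).smul (x ^ p₁ * y ^ q₁)
  rw [← hF] at h5
  convert h5 using 1
  ext i j
  fin_cases i <;> fin_cases j <;> simp [consDiagonal] <;> ring

end AxisSmith

section Minors

variable {R : Type*} [CommRing R] {m : ℕ}

theorem JEqTop.span_minorsSet {k : ℕ} {F : Matrix (Fin m) (Fin m) R} (h : JEqTop k F) {e : R}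
    (he : ∀ d, IsGcdMinors k F d → Associated d e) :
    Ideal.span (minorsSet k F) = Ideal.span {e} := by
  obtain ⟨d, hd, htop⟩ := h
  obtain ⟨u, rfl⟩ := he d hd
  rw [Ideal.span_singleton_mul_right_unit u.isUnit]
  apply le_antisymm
  · rw [Ideal.span_le]
    exact fun a ha => Ideal.mem_span_singleton.mpr (hd.1 a ha)
  · rw [← Ideal.mul_top (Ideal.span {d}), ← htop, Ideal.span_mul_span', Ideal.span_le]
    rintro _ ⟨d', hd', b, hb, rfl⟩
    rw [Set.mem_singleton_iff] at hd'
    subst hd'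
    exact Ideal.subset_span hb

theorem span_minorsSet_one (F : Matrix (Fin m) (Fin m) R) :
    Ideal.span (minorsSet 1 F) = F.entryIdeal := by
  apply le_antisymm
  · rw [Ideal.span_le]
    rintro _ ⟨ri, ci, -, -, rfl⟩
    rw [Matrix.det_fin_one]
    exact F.apply_mem_entryIdeal _ _
  · rw [Matrix.entryIdeal_le]
    intro i j
    exact Ideal.subset_span ⟨fun _ => i, fun _ => j, Function.injective_of_subsingleton _,
      Function.injective_of_subsingleton _, by rw [Matrix.det_fin_one]; rfl⟩

theorem span_minorsSet_two (F : Matrix (Fin 3) (Fin 3) R) :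
    Ideal.span (minorsSet 2 F) = F.adjugate.entryIdeal := by
  apply le_antisymm
  · rw [Ideal.span_le]
    rintro _ ⟨ri, ci, -, -, rfl⟩
    rw [Matrix.det_fin_two]
    exact F.minor_mem_entryIdeal_adjugate _ _ _ _
  · rw [Matrix.entryIdeal_le]
    intro i j
    rw [Matrix.adjugate_fin_succ_eq_det_submatrix]
    exact Ideal.mul_mem_left _ _ (Ideal.subset_span ⟨_, _, Fin.succAbove_right_injective,
      Fin.succAbove_right_injective, rfl⟩)

theorem isGcdMinors_det (F : Matrix (Fin m) (Fin m) R) : IsGcdMinors m F F.det := by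
  refine ⟨?_, fun e he => he _ ⟨id, id, Function.injective_id, Function.injective_id, rfl⟩⟩
  rintro _ ⟨ri, ci, -, -, rfl⟩
  have h : F.submatrix ri ci =
      (1 : Matrix (Fin m) (Fin m) R).submatrix ri id * F * (1 : Matrix _ _ R).submatrix id ci := by
    ext i j
    simp [Matrix.mul_apply, Matrix.one_apply]
  rw [h, Matrix.det_mul, Matrix.det_mul]
  exact Dvd.dvd.mul_right (dvd_mul_left _ _) _

end Minors

section AxisRetractions

variable {K σ : Type*} [Field K] [DecidableEq σ]

/-- The endomorphism of a polynomial ring that sends one variable to zero. -/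
noncomputable def MvPolynomial.killVar (v : σ) : MvPolynomial σ K →ₐ[K] MvPolynomial σ K :=
  aeval fun i => if i = v then 0 else X i

theorem MvPolynomial.killVar_X (v i : σ) :
    killVar (K := K) v (X i) = if i = v then 0 else X i := by
  simp [killVar]

theorem MvPolynomial.killVar_comm (v w : σ) (a : MvPolynomial σ K) :
    killVar v (killVar w a) = killVar w (killVar v a) := by
  have : (killVar (K := K) v).comp (killVar w) = (killVar w).comp (killVar v) := by
    ext i : 1
    by_cases hv : i = v <;> by_cases hw : i = w <;> simp [killVar_X, hv, hw] <;>
      simp_all [killVar_X]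
  exact DFunLike.congr_fun this a

theorem MvPolynomial.killVar_killVar (v : σ) (a : MvPolynomial σ K) :
    killVar v (killVar v a) = killVar v a := by
  have : (killVar (K := K) v).comp (killVar v) = killVar v := by
    ext i : 1
    by_cases hv : i = v <;> simp [killVar_X, hv]
  exact DFunLike.congr_fun this a

theorem MvPolynomial.X_dvd_sub_killVar (v : σ) (a : MvPolynomial σ K) :
    X v ∣ a - killVar v a := by
  rw [← Ideal.mem_span_singleton, ← Ideal.Quotient.eq]
  have : (Ideal.Quotient.mkₐ K (Ideal.span {X v})).comp (killVar (K := K) v) =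
      Ideal.Quotient.mkₐ K (Ideal.span {X v}) := by
    ext i : 1
    by_cases hv : i = v
    · subst hv
      simp [killVar_X]
    · simp [killVar_X, hv]
  exact (DFunLike.congr_fun this a).symm

theorem MvPolynomial.axisRetractions {v w : σ} (h : v ≠ w) :
    AxisRetractions (X v : MvPolynomial σ K) (X w) (killVar (K := K) v).toRingHom
      (killVar (K := K) w).toRingHom where
  comm := killVar_comm v w
  left_left := killVar_killVar v
  right_right := killVar_killVar w
  left_x := by simp [killVar_X]
  left_y := by simp [killVar_X, h.symm]
  right_x := by simp [killVar_X, h]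
  right_y := by simp [killVar_X]
  x_dvd := X_dvd_sub_killVar v
  y_dvd := X_dvd_sub_killVar w

end AxisRetractions

/-- Let `F ∈ R^{3×3}` with `det F` associated to `x₁^p x₂^q` (`p, q > 0`)
and `d_i(F)` associated to `x₁^{p_i}x₂^{q_i}`.  If `J_i(F) = R` for `i = 1,2,3`, then `F`
is equivalent to `diag(x₁^{r_1}x₂^{s_1}, x₁^{r_2}x₂^{s_2}, x₁^{r_3}x₂^{s_3})` with
`r_i = p_i - p_{i-1}`, `s_i = q_i - q_{i-1}` (`p_0 = q_0 = 0`), and moreover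
`r_1 ≤ r_2 ≤ r_3` and `s_1 ≤ s_2 ≤ s_3`. -/
theorem statement15 {K : Type*} [Field K] {n : ℕ}
    (v1 v2 : Fin n) (hv1 : (v1 : ℕ) = 0) (hv2 : (v2 : ℕ) = 1)
    (F : Matrix (Fin 3) (Fin 3) (MvPolynomial (Fin n) K))
    (p q : ℕ) (hp : 0 < p) (hq : 0 < q)
    (hdet : Associated F.det (X v1 ^ p * X v2 ^ q))
    (pk qk : ℕ → ℕ) (hpk0 : pk 0 = 0) (hqk0 : qk 0 = 0)
    (hd : ∀ i, 1 ≤ i → i ≤ 3 → ∀ d, IsGcdMinors i F d →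
      Associated d (X v1 ^ pk i * X v2 ^ qk i))
    (hJ : ∀ i, 1 ≤ i → i ≤ 3 → JEqTop i F) :
    MatEquiv F (Matrix.diagonal (fun i : Fin 3 =>
      X v1 ^ (pk ((i : ℕ) + 1) - pk (i : ℕ)) * X v2 ^ (qk ((i : ℕ) + 1) - qk (i : ℕ)))) ∧
    (∀ i j, 1 ≤ i → i ≤ j → j ≤ 3 →
      pk i - pk (i - 1) ≤ pk j - pk (j - 1) ∧ qk i - qk (i - 1) ≤ qk j - qk (j - 1)) := by
  have hne : v1 ≠ v2 := fun h => by rw [h, hv2] at hv1; omega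
  have h₁ := (hJ 1 le_rfl (by norm_num)).span_minorsSet (hd 1 le_rfl (by norm_num))
  have h₂ := (hJ 2 (by norm_num) (by norm_num)).span_minorsSet (hd 2 (by norm_num) (by norm_num))
  rw [span_minorsSet_one] at h₁
  rw [span_minorsSet_two] at h₂
  have h₃ := hd 3 (by norm_num) le_rfl F.det (isGcdMinors_det F)
  obtain ⟨a, b, c, d, hp₂, hq₂, hp₃, hq₃, hF⟩ :=
    (MvPolynomial.axisRetractions (K := K) hne).matEquiv_fin_three (X_ne_zero v1) (X_ne_zero v2)
      (fun f hf => hf.vecEquiv_single 0) h₁ h₂ h₃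
  constructor
  · convert hF using 2
    ext1 i
    fin_cases i
    · simp [hpk0, hqk0]
    · have e₁ : pk 2 - pk 1 = pk 1 + a := by omega
      have e₂ : qk 2 - qk 1 = qk 1 + b := by omega
      simp [e₁, e₂]
    · have e₁ : pk 3 - pk 2 = pk 1 + a + c := by omega
      have e₂ : qk 3 - qk 2 = qk 1 + b + d := by omega
      simp [e₁, e₂]
  · intro i j hi hij hj
    have hj' : 1 ≤ j := hi.trans hij
    have hi' : i ≤ 3 := hij.trans hj
    interval_cases i <;> interval_cases j <;> simp only [Nat.reduceSub, le_refl, and_self] <;> omega
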